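/- For partitions α, β of n and a partition ν of n, lr(α,β;ν) = Σ_{γ ⊵ ν} K_{γν} · k(α,β,γ), where the sum is over partitions γ of n dominating ν. -/

import Mathlib

open Finset Equiv
open scoped Classical

noncomputable section

/-- Value at `g` of the permutation character of `S_n` induced from the trivial character of
the Young subgroup of the composition `c`: the number of colorings of `Fin n` with fiber
sizes given by `c` that are fixed by `g`. -/
def permChar (n : ℕ) (c : ℕ → ℕ) (g : Perm (Fin n)) : ℚ :=
  Nat.card {f : Fin n → ℕ // (∀ k, Nat.card {x : Fin n // f x = k} = c k) ∧ ∀ x, f (g x) = f x}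

/-- Inner product of class functions (real-valued characters) of `S_n`. -/
def innerChar (n : ℕ) (χ ψ : Perm (Fin n) → ℚ) : ℚ :=
  (∑ g : Perm (Fin n), χ g * ψ g) / (n.factorial : ℚ)

/-- The trivial character `χ^{(n)}` of `S_n`. -/
def trivChar (n : ℕ) : Perm (Fin n) → ℚ := fun _ => 1

/-- The sign character `χ^{(1^n)}` of `S_n`. -/
def signChar (n : ℕ) : Perm (Fin n) → ℚ := fun g => ((Perm.sign g : ℤ) : ℚ)

/-- Permutation character for an integer vector: zero if some entry is negative. -/
def permCharZ (n : ℕ) (c : ℕ → ℤ) (g : Perm (Fin n)) : ℚ :=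
  if ∀ k, 0 ≤ c k then permChar n (fun k => (c k).toNat) g else 0

/-- The irreducible character `χ^a` of `S_n` indexed by the partition `a`, given by the
Jacobi–Trudi determinantal formula `χ^a = ∑_σ sgn(σ) φ^{(a_i - i + σ(i))_i}`. -/
def irrChar (n : ℕ) (a : ℕ → ℕ) (g : Perm (Fin n)) : ℚ :=
  ∑ σ : Perm (Fin n), ((Perm.sign σ : ℤ) : ℚ) *
    permCharZ n (fun i => if h : i < n then (a i : ℤ) - i + ((σ ⟨i, h⟩ : Fin n) : ℕ) else 0) g

/-- Kronecker coefficient `k(a,b,c) = ⟨χ^a ⊗ χ^b, χ^c⟩`. -/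
def kron (n : ℕ) (a b c : ℕ → ℕ) : ℚ :=
  innerChar n (fun g => irrChar n a g * irrChar n b g) (irrChar n c)

/-- Extend a vector indexed by `Fin p` to `ℕ` by zeros. -/
def extc {p : ℕ} (l : Fin p → ℕ) : ℕ → ℕ := fun i => if h : i < p then l ⟨i, h⟩ else 0

/-- Dominance order: `a ⊵ b`. -/
def Dominates (a b : ℕ → ℕ) : Prop :=
  ∀ k, ∑ i ∈ Finset.range k, b i ≤ ∑ i ∈ Finset.range k, a i

/-- Conjugate (transpose) of a partition with at most `n` parts. -/
def conjFun (n : ℕ) (a : ℕ → ℕ) : ℕ → ℕ :=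
  fun j => ((Finset.range n).filter (fun i => j < a i)).card

/-- `a` is a partition of `n` (weakly decreasing, supported on the first `n` parts). -/
def IsPartitionFun (n : ℕ) (a : ℕ → ℕ) : Prop :=
  (∀ i j, i ≤ j → a j ≤ a i) ∧ (∀ i, n ≤ i → a i = 0) ∧ ∑ i ∈ Finset.range n, a i = n

/-- The weakly decreasing sequence of parts of `P : Nat.Partition n`. -/
def pf {n : ℕ} (P : n.Partition) : ℕ → ℕ :=
  fun i => ((P.parts.sort (· ≤ ·)).reverse).getD i 0

/-- The parts of `P : Nat.Partition n` as a vector of length `n`. -/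
def pfin {n : ℕ} (P : n.Partition) : Fin n → ℕ := fun k => pf P k

/-- Number of cells of the skew shape `a/b` where the filling `T` has entry `k`. -/
def skewContent (a b : ℕ → ℕ) (T : ℕ → ℕ → ℕ) (k : ℕ) : ℕ :=
  Nat.card {p : ℕ × ℕ // b p.1 ≤ p.2 ∧ p.2 < a p.1 ∧ T p.1 p.2 = k}

/-- Number of cells of the skew shape `a/b`. -/
def skewSize (a b : ℕ → ℕ) : ℕ :=
  Nat.card {p : ℕ × ℕ // b p.1 ≤ p.2 ∧ p.2 < a p.1}

/-- `T` is a semistandard filling of the shape `a` (zero outside, rows weakly increasing,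
columns strictly increasing). -/
def IsSSYT (a : ℕ → ℕ) (T : ℕ → ℕ → ℕ) : Prop :=
  (∀ i j, a i ≤ j → T i j = 0) ∧
  (∀ i j₁ j₂, j₁ ≤ j₂ → j₂ < a i → T i j₁ ≤ T i j₂) ∧
  (∀ i₁ i₂ j, i₁ < i₂ → j < a i₂ → T i₁ j < T i₂ j)

/-- The Kostka number: the number of semistandard Young tableaux of shape `a`
and content `c`. -/
def kostka (a c : ℕ → ℕ) : ℕ :=
  Nat.card {T : ℕ → ℕ → ℕ // IsSSYT a T ∧ ∀ k, skewContent a (fun _ => 0) T k = c k}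

/-- Number of entries equal to `k` in the prefix of the (right-to-left, top-to-bottom)
reading word of `T` ending at position `(i,j)`. -/
def lrCount (a b : ℕ → ℕ) (T : ℕ → ℕ → ℕ) (i j k : ℕ) : ℕ :=
  Nat.card {p : ℕ × ℕ //
    (p.1 < i ∨ (p.1 = i ∧ j ≤ p.2)) ∧ b p.1 ≤ p.2 ∧ p.2 < a p.1 ∧ T p.1 p.2 = k}

/-- `T` is a Littlewood–Richardson skew tableau of shape `a/b`: semistandard and its
reverse reading word is a lattice word. -/
def IsLR (a b : ℕ → ℕ) (T : ℕ → ℕ → ℕ) : Prop :=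
  (∀ i j, ¬(b i ≤ j ∧ j < a i) → T i j = 0) ∧
  (∀ i j₁ j₂, b i ≤ j₁ → j₁ ≤ j₂ → j₂ < a i → T i j₁ ≤ T i j₂) ∧
  (∀ i₁ i₂ j, i₁ < i₂ → b i₁ ≤ j → j < a i₁ → b i₂ ≤ j → j < a i₂ → T i₁ j < T i₂ j) ∧
  (∀ i j k, lrCount a b T i j (k + 1) ≤ lrCount a b T i j k)

/-- A Littlewood–Richardson multitableau of shape `α` with `r` parts: a chain of
partitions `0 = α(0) ⊆ α(1) ⊆ ⋯ ⊆ α(r) = α` together with Littlewood–Richardson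
fillings of the successive skew shapes. -/
structure LRMultiF (r : ℕ) (α : ℕ → ℕ) where
  chain : Fin (r + 1) → ℕ → ℕ
  antitone : ∀ k i j, i ≤ j → chain k j ≤ chain k i
  zero : ∀ i, chain 0 i = 0
  last : ∀ i, chain (Fin.last r) i = α i
  mono : ∀ (k : Fin r) (i : ℕ), chain k.castSucc i ≤ chain k.succ i
  T : Fin r → ℕ → ℕ → ℕ
  lr : ∀ k : Fin r, IsLR (chain k.succ) (chain k.castSucc) (T k)

/-- Content of the `k`-th tableau of a Littlewood–Richardson multitableau. -/
def LRMultiF.cont {r : ℕ} {α : ℕ → ℕ} (M : LRMultiF r α) (k : Fin r) : ℕ → ℕ :=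
  skewContent (M.chain k.succ) (M.chain k.castSucc) (M.T k)

/-- Size of the `k`-th tableau of a Littlewood–Richardson multitableau. -/
def LRMultiF.size {r : ℕ} {α : ℕ → ℕ} (M : LRMultiF r α) (k : Fin r) : ℕ :=
  skewSize (M.chain k.succ) (M.chain k.castSucc)

/-- `LR(α,β;ν)`: pairs of Littlewood–Richardson multitableaux of shapes `α`, `β`,
type `ν`, with equal contents. -/
def LRPairs (r : ℕ) (α β : ℕ → ℕ) (ν : Fin r → ℕ) :=
  {TS : LRMultiF r α × LRMultiF r β //
    (∀ k, TS.1.size k = ν k) ∧ (∀ k, TS.2.size k = ν k) ∧ ∀ k, TS.1.cont k = TS.2.cont k}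

/-- `LR*(α,β;ν)`: pairs of Littlewood–Richardson multitableaux of shapes `α`, `β`,
type `ν`, with termwise conjugate contents. -/
def LRPairsStar (n r : ℕ) (α β : ℕ → ℕ) (ν : Fin r → ℕ) :=
  {TS : LRMultiF r α × LRMultiF r β //
    (∀ k, TS.1.size k = ν k) ∧ (∀ k, TS.2.size k = ν k) ∧
      ∀ k m, TS.2.cont k m = conjFun n (TS.1.cont k) m}

/-- `lr(α,β;ν)`. -/
def lrNum (r : ℕ) (α β : ℕ → ℕ) (ν : Fin r → ℕ) : ℕ := Nat.card (LRPairs r α β ν)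

/-- `lr*(α,β;ν)`. -/
def lrStarNum (n r : ℕ) (α β : ℕ → ℕ) (ν : Fin r → ℕ) : ℕ :=
  Nat.card (LRPairsStar n r α β ν)

/-- A semistandard Young tableau (of arbitrary partition shape). -/
structure SSYTP where
  shape : ℕ → ℕ
  T : ℕ → ℕ → ℕ
  antitone : ∀ i j, i ≤ j → shape j ≤ shape i
  finite : ∃ N, ∀ i, N ≤ i → shape i = 0
  ssyt : IsSSYT shape T

/-- Content of a semistandard Young tableau. -/
def SSYTP.cont (P : SSYTP) : ℕ → ℕ := skewContent P.shape (fun _ => 0) P.T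

/-- The multiset of entries of a matrix. -/
def entriesM {p q : ℕ} (A : Fin p → Fin q → ℕ) : Multiset ℕ :=
  (Finset.univ : Finset (Fin p × Fin q)).val.map (fun ij => A ij.1 ij.2)

/-- The π-sequence of `A` is the partition `ν` (the weakly decreasing rearrangement of
the entries of `A` is `ν`). -/
def HasPiSeq {p q : ℕ} (A : Fin p → Fin q → ℕ) {n : ℕ} (ν : n.Partition) : Prop :=
  (entriesM A).filter (· ≠ 0) = ν.parts

end

noncomputable section

/-- Alternating functions on integer vectors. -/
def IsAlt {n : ℕ} (A : (Fin n → ℤ) → ℚ) : Prop :=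
  ∀ (σ : Perm (Fin n)) (e : Fin n → ℤ), A (e ∘ σ) = ((Perm.sign σ : ℤ) : ℚ) * A e

/-- Subtract the staircase vector `(0, 1, …, n - 1)`. -/
def shiftVec {n : ℕ} (e : Fin n → ℤ) : Fin n → ℤ := fun i => e i - (i : ℕ)

/-- Restriction of a sequence of natural numbers to an integer vector of length `n`. -/
def vec (n : ℕ) (a : ℕ → ℕ) : Fin n → ℤ := fun i => (a i : ℤ)

/-- `a` is a partition of `m` with at most `n` parts. -/
structure IsShape (n m : ℕ) (a : ℕ → ℕ) : Prop where
  anti : ∀ i j, i ≤ j → a j ≤ a i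
  supp : ∀ i, n ≤ i → a i = 0
  total : ∑ i ∈ range n, a i = m

/-- Partitions of `m` with at most `n` parts. -/
abbrev Shape (n m : ℕ) := {a : ℕ → ℕ // IsShape n m a}

/-- Chains of shapes from `b` to `a` whose successive differences are horizontal strips;
`g k i` is the number of cells of row `i` that lie in `b` or have an entry less than `k`. -/
structure IsTab (n : ℕ) (b a : ℕ → ℕ) (g : ℕ → ℕ → ℕ) : Prop where
  zero : ∀ i, g 0 i = b i
  mono : ∀ k i, g k i ≤ g (k + 1) i
  last : ∀ k i, n ≤ k → g k i = a i
  strict : ∀ k i, g (k + 1) (i + 1) ≤ g k i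

/-- Semistandard tableaux of shape `a` with entries less than `n`, as chains of shapes. -/
abbrev Tab (n : ℕ) (a : ℕ → ℕ) := {g : ℕ → ℕ → ℕ // IsTab n (fun _ => 0) a g}

/-- The number of entries `k` in the tableau given by the chain `g`. -/
def wtF (n : ℕ) (g : ℕ → ℕ → ℕ) (k : ℕ) : ℤ := ∑ i ∈ range n, ((g (k + 1) i : ℤ) - g k i)

/-- The content vector of the tableau given by the chain `g`. -/
def wt (n : ℕ) (g : ℕ → ℕ → ℕ) : Fin n → ℤ := fun k => wtF n g k

/-- Arbitrary chains of finitely supported vectors starting at zero, of total size `m`. -/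
structure IsPile (n m : ℕ) (g : ℕ → ℕ → ℕ) : Prop where
  zero : ∀ i, g 0 i = 0
  mono : ∀ k i, g k i ≤ g (k + 1) i
  last : ∀ k i, n ≤ k → g k i = g n i
  supp : ∀ k i, n ≤ i → g k i = 0
  total : ∑ i ∈ range n, g n i = m

/-- The type of chains satisfying `IsPile`. -/
abbrev Pile (n m : ℕ) := {g : ℕ → ℕ → ℕ // IsPile n m g}

/-- Matrices of natural numbers with total sum `m`. -/
abbrev Mat (n m : ℕ) := {M : Fin n → Fin n → ℕ // ∑ k, ∑ i, M k i = m}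

/-- The sums `∑ k, M k i`. -/
def rowSum {n : ℕ} (M : Fin n → Fin n → ℕ) : Fin n → ℤ := fun i => ∑ k, (M k i : ℤ)

/-- The sums `∑ i, M k i`. -/
def colSum {n : ℕ} (M : Fin n → Fin n → ℕ) : Fin n → ℤ := fun k => ∑ i, (M k i : ℤ)

lemma mono_of_step {g : ℕ → ℕ → ℕ} (h : ∀ k i, g k i ≤ g (k + 1) i) {k l : ℕ} (hkl : k ≤ l)
    (i : ℕ) : g k i ≤ g l i :=
  monotone_nat_of_le_succ (f := fun k => g k i) (fun k => h k i) hkl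

lemma finite_bounded_arrays (n N : ℕ) :
    {g : ℕ → ℕ → ℕ | (∀ k i, g k i ≤ N) ∧ (∀ k i, n ≤ i → g k i = 0) ∧
      ∀ k i, n ≤ k → g k i = g n i}.Finite := by
  apply Set.Finite.of_finite_image (f := fun g => fun (k : Fin (n + 1)) (i : Fin n) => g k i)
  · apply Set.Finite.subset (Set.finite_Icc (0 : Fin (n + 1) → Fin n → ℕ) (fun _ _ => N))
    rintro _ ⟨g, hg, rfl⟩
    exact ⟨fun _ _ => Nat.zero_le _, fun k i => hg.1 k i⟩
  · intro g hg g' hg' h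
    have key : ∀ k i, k ≤ n → i < n → g k i = g' k i := fun k i hk hi =>
      congrFun (congrFun h ⟨k, by omega⟩) ⟨i, hi⟩
    have key2 : ∀ k i, k ≤ n → g k i = g' k i := by
      intro k i hk
      by_cases hi : i < n
      · exact key k i hk hi
      · rw [hg.2.1 k i (by omega), hg'.2.1 k i (by omega)]
    funext k i
    by_cases hk : k ≤ n
    · exact key2 k i hk
    · rw [hg.2.2 k i (by omega), hg'.2.2 k i (by omega)]
      exact key2 n i le_rfl

lemma IsTab.eq_zero {n : ℕ} {a : ℕ → ℕ} {g : ℕ → ℕ → ℕ} (h : IsTab n (fun _ => 0) a g) :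
    ∀ k i, k ≤ i → g k i = 0 := by
  intro k
  induction k with
  | zero => intro i _; exact h.zero i
  | succ k ih =>
    intro i hi
    obtain ⟨j, rfl⟩ : ∃ j, i = j + 1 := ⟨i - 1, by omega⟩
    have := h.strict k j
    rw [ih j (by omega)] at this
    omega

lemma IsTab.le_last {n : ℕ} {b a : ℕ → ℕ} {g : ℕ → ℕ → ℕ} (h : IsTab n b a g) (k i : ℕ) :
    g k i ≤ a i := by
  rw [← h.last (max k n) i (le_max_right _ _)]
  exact mono_of_step h.mono (le_max_left _ _) i

lemma IsTab.first_le {n : ℕ} {b a : ℕ → ℕ} {g : ℕ → ℕ → ℕ} (h : IsTab n b a g) (k i : ℕ) :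
    b i ≤ g k i := by
  rw [← h.zero i]
  exact mono_of_step h.mono (Nat.zero_le _) i

lemma IsTab.anti {n : ℕ} {b a : ℕ → ℕ} {g : ℕ → ℕ → ℕ} (h : IsTab n b a g) :
    ∀ i j, i ≤ j → a j ≤ a i := by
  intro i j hij
  refine antitone_nat_of_succ_le (f := a) (fun i => ?_) hij
  have := h.strict n i
  rwa [h.last n i le_rfl, h.last (n + 1) _ (by omega)] at this

lemma IsTab.supp {n : ℕ} {a : ℕ → ℕ} {g : ℕ → ℕ → ℕ} (h : IsTab n (fun _ => 0) a g) :
    ∀ i, n ≤ i → a i = 0 := by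
  intro i hi
  rw [← h.last n i le_rfl]
  exact h.eq_zero n i hi

instance (n : ℕ) (a : ℕ → ℕ) : Finite (Tab n a) := by
  refine Set.Finite.subset (finite_bounded_arrays n (a 0)) ?_
  intro g hg
  have hg : IsTab n (fun _ => 0) a g := hg
  refine ⟨fun k i => (hg.le_last k i).trans (hg.anti 0 i (Nat.zero_le _)), fun k i hi => ?_,
    fun k i hk => ?_⟩
  · have := hg.le_last k i
    rw [hg.supp i hi] at this
    omega
  · rw [hg.last k i hk, hg.last n i le_rfl]

instance (n : ℕ) (a : ℕ → ℕ) : Fintype (Tab n a) := Fintype.ofFinite _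

instance (n m : ℕ) : Finite (Pile n m) := by
  refine Set.Finite.subset (finite_bounded_arrays n m) ?_
  intro g hg
  have hg : IsPile n m g := hg
  refine ⟨fun k i => ?_, hg.supp, hg.last⟩
  by_cases hi : i < n
  · have h1 : g k i ≤ g n i := by
      rw [← hg.last (max k n) i (le_max_right _ _)]
      exact mono_of_step hg.mono (le_max_left _ _) i
    have h2 := Finset.single_le_sum (f := fun i => g n i) (fun i _ => Nat.zero_le _)
      (Finset.mem_range.2 hi)
    have h3 := hg.total
    omega
  · rw [hg.supp k i (by omega)]
    exact Nat.zero_le _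

instance (n m : ℕ) : Fintype (Pile n m) := Fintype.ofFinite _

instance (n m : ℕ) : Finite (Mat n m) := by
  refine Set.Finite.subset (Set.finite_Icc (0 : Fin n → Fin n → ℕ) (fun _ _ => m)) ?_
  intro M hM
  have hM : ∑ k, ∑ i, M k i = m := hM
  refine ⟨fun _ _ => Nat.zero_le _, fun k i => ?_⟩
  have h1 := Finset.single_le_sum (f := fun i => M k i) (fun i _ => Nat.zero_le _)
      (Finset.mem_univ i)
  have h2 := Finset.single_le_sum (f := fun k => ∑ i, M k i) (fun i _ => Nat.zero_le _)
      (Finset.mem_univ k)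
  exact (h1.trans h2).trans hM.le

instance (n m : ℕ) : Fintype (Mat n m) := Fintype.ofFinite _

instance (n m : ℕ) : Finite (Shape n m) := by
  have : Set.InjOn (fun a : ℕ → ℕ => fun _ : ℕ => a) {a | IsShape n m a} :=
    fun a _ b _ h => congrFun h 0
  refine Set.Finite.of_finite_image (Set.Finite.subset (finite_bounded_arrays n m) ?_) this
  rintro _ ⟨a, ha, rfl⟩
  have ha : IsShape n m a := ha
  refine ⟨fun k i => ?_, fun _ => ha.supp, fun _ _ _ => rfl⟩
  by_cases hi : i < n
  · have h2 := Finset.single_le_sum (f := fun i => a i) (fun i _ => Nat.zero_le _)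
      (Finset.mem_range.2 hi)
    have h3 := ha.total
    simp only at h2 ⊢
    omega
  · simp [ha.supp i (by omega)]

instance (n m : ℕ) : Fintype (Shape n m) := Fintype.ofFinite _

/-- Cancellation of a signed sum along a sign-reversing involution which is given separately
on the pieces labelled by `x`. -/
lemma sum_eq_sum_of_involution {G ι : Type*} {P : G → Prop} [Fintype {g // P g}]
    (B : G → ι → Prop) (inv : ι → G → G) (f : G → ℚ)
    (huniq : ∀ g x y, P g → B g x → B g y → x = y)
    (hmem : ∀ g x, P g → B g x → P (inv x g))
    (hpres : ∀ g x, P g → B g x → B (inv x g) x)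
    (hinv : ∀ g x, P g → B g x → inv x (inv x g) = g)
    (hneg : ∀ g x, P g → B g x → f (inv x g) = - f g) :
    ∑ g : {g // P g}, f g.1 = ∑ g : {g // P g}, if ∀ x, ¬ B g.1 x then f g.1 else 0 := by
  rcases isEmpty_or_nonempty ι with hι | hι
  · simp
  rw [← Finset.sum_filter, ← Finset.sum_filter_add_sum_filter_not univ
    (fun g : {g // P g} => ∀ x, ¬ B g.1 x) (fun g => f g.1)]
  have hB : ∀ g ∈ univ.filter (fun g : {g // P g} => ¬ ∀ x, ¬ B g.1 x), ∃ x, B g.1 x := by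
    intro g hg
    simpa using (Finset.mem_filter.1 hg).2
  simp only [add_eq_left]
  choose! x hx using hB
  have mem : ∀ g (hg : g ∈ univ.filter (fun g : {g // P g} => ¬ ∀ x, ¬ B g.1 x)),
      (⟨inv (x g) g.1, hmem _ _ g.2 (hx g hg)⟩ : {g // P g}) ∈
        univ.filter (fun g : {g // P g} => ¬ ∀ x, ¬ B g.1 x) := by
    intro g hg
    simp only [Finset.mem_filter, Finset.mem_univ, true_and, not_forall, not_not]
    exact ⟨x g, hpres _ _ g.2 (hx g hg)⟩
  refine Finset.sum_involution (fun g hg => ⟨inv (x g) g.1, hmem _ _ g.2 (hx g hg)⟩) ?_ ?_ mem ?_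
  · intro g hg
    simp only
    rw [hneg _ _ g.2 (hx g hg)]
    ring
  · intro g hg h0 h
    have h1 := hneg _ _ g.2 (hx g hg)
    have h2 := congrArg Subtype.val h
    simp only at h2
    rw [h2] at h1
    apply h0
    linarith
  · intro g hg
    have h1 := hx _ (mem g hg)
    have h2 := hpres _ _ g.2 (hx g hg)
    have h3 := huniq _ _ _ (hmem _ _ g.2 (hx g hg)) h1 h2
    apply Subtype.ext
    simp only
    rw [h3]
    exact hinv _ _ g.2 (hx g hg)

lemma IsAlt.swap {n : ℕ} {A : (Fin n → ℤ) → ℚ} (hA : IsAlt A) {e e' : Fin n → ℤ} {i : ℕ}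
    (hi : i + 1 < n) (h1 : e' ⟨i, by omega⟩ = e ⟨i + 1, hi⟩) (h2 : e' ⟨i + 1, hi⟩ = e ⟨i, by omega⟩)
    (h3 : ∀ j : Fin n, (j : ℕ) ≠ i → (j : ℕ) ≠ i + 1 → e' j = e j) : A e' = - A e := by
  have : e' = e ∘ Equiv.swap (⟨i, by omega⟩ : Fin n) ⟨i + 1, hi⟩ := by
    funext j
    simp only [Function.comp]
    by_cases hj : j = ⟨i, by omega⟩
    · rw [hj, Equiv.swap_apply_left, h1]
    · by_cases hj' : j = ⟨i + 1, hi⟩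
      · rw [hj', Equiv.swap_apply_right, h2]
      · rw [Equiv.swap_apply_of_ne_of_ne hj hj']
        exact h3 j (fun h => hj (Fin.ext h)) (fun h => hj' (Fin.ext h))
  rw [this, hA, Perm.sign_swap (by simp)]
  simp

end

noncomputable section

/-- The first step `x.1` of the chain `g` which is not a horizontal strip, together with the
last row `x.2` where this fails. -/
def StepBad (g : ℕ → ℕ → ℕ) (x : ℕ × ℕ) : Prop :=
  (∀ k < x.1, ∀ i, g (k + 1) (i + 1) ≤ g k i) ∧ g x.1 x.2 < g (x.1 + 1) (x.2 + 1) ∧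
    ∀ i, x.2 < i → g (x.1 + 1) (i + 1) ≤ g x.1 i

/-- Swap the rows `x.2` and `x.2 + 1` (in shifted coordinates) after step `x.1`. -/
def stepSwap (x : ℕ × ℕ) (g : ℕ → ℕ → ℕ) : ℕ → ℕ → ℕ := fun k i =>
  if k ≤ x.1 then g k i else if i = x.2 then g k (x.2 + 1) - 1
    else if i = x.2 + 1 then g k x.2 + 1 else g k i

lemma stepBad_unique {g : ℕ → ℕ → ℕ} {x y : ℕ × ℕ} (hx : StepBad g x) (hy : StepBad g y) :
    x = y := by
  obtain ⟨k, i⟩ := x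
  obtain ⟨l, j⟩ := y
  obtain ⟨h1, h2, h3⟩ := hx
  obtain ⟨h1', h2', h3'⟩ := hy
  simp only at *
  have hkl : k = l := by
    rcases lt_trichotomy k l with h | h | h
    · have := h1' k h i
      omega
    · exact h
    · have := h1 l h j
      omega
  subst hkl
  have hij : i = j := by
    rcases lt_trichotomy i j with h | h | h
    · have := h3 j h
      omega
    · exact h
    · have := h3' i h
      omega
  rw [hij]

lemma exists_stepBad {n m : ℕ} {g : ℕ → ℕ → ℕ} (hg : IsPile n m g)
    (h : ∃ k i, g k i < g (k + 1) (i + 1)) : ∃ x, StepBad g x := by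
  have hk := Nat.find_spec h
  set k := Nat.find h with hkdef
  have hlt : ∀ k' < k, ∀ i, g (k' + 1) (i + 1) ≤ g k' i := by
    intro k' hk' i
    have := Nat.find_min h hk'
    push Not at this
    exact this i
  have hn : ∀ i, g k i < g (k + 1) (i + 1) → i ≤ n := by
    intro i hi
    by_contra hc
    rw [hg.supp (k + 1) (i + 1) (by omega)] at hi
    omega
  obtain ⟨i0, hi0⟩ := hk
  have hspec := Nat.findGreatest_spec (P := fun i => g k i < g (k + 1) (i + 1)) (hn i0 hi0) hi0
  refine ⟨(k, Nat.findGreatest (fun i => g k i < g (k + 1) (i + 1)) n), hlt, hspec, ?_⟩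
  intro i hi
  simp only at hi ⊢
  by_contra hc
  push Not at hc
  exact Nat.findGreatest_is_greatest hi (hn i hc) hc

lemma stepBad_anti {n m : ℕ} {g : ℕ → ℕ → ℕ} (hg : IsPile n m g) {k : ℕ}
    (h : ∀ k' < k, ∀ i, g (k' + 1) (i + 1) ≤ g k' i) (i : ℕ) : g k (i + 1) ≤ g k i := by
  cases k with
  | zero => rw [hg.zero, hg.zero]
  | succ k => exact (h k (Nat.lt_succ_self k) i).trans (hg.mono k i)

lemma stepBad_lt {n m : ℕ} {g : ℕ → ℕ → ℕ} (hg : IsPile n m g) {x : ℕ × ℕ}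
    (hx : StepBad g x) : x.1 < n ∧ x.2 + 1 < n := by
  obtain ⟨h1, h2, h3⟩ := hx
  constructor
  · by_contra hc
    have := stepBad_anti hg h1 x.2
    rw [hg.last (x.1 + 1) _ (by omega), hg.last x.1 _ (by omega)] at h2
    rw [hg.last x.1 _ (by omega), hg.last x.1 _ (by omega)] at this
    omega
  · by_contra hc
    rw [hg.supp (x.1 + 1) (x.2 + 1) (by omega)] at h2
    omega

lemma stepBad_bounds {n m : ℕ} {g : ℕ → ℕ → ℕ} (hg : IsPile n m g) {x : ℕ × ℕ}
    (hx : StepBad g x) : ∀ k, x.1 < k → g x.1 x.2 < g k (x.2 + 1) ∧ g x.1 (x.2 + 1) ≤ g k x.2 := by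
  intro k hk
  have h1 := mono_of_step hg.mono (show x.1 + 1 ≤ k from hk) (x.2 + 1)
  have h2 := mono_of_step hg.mono hk.le x.2
  have h3 := stepBad_anti hg hx.1 x.2
  have := hx.2.1
  omega

lemma sum_stepSwap {n m : ℕ} {g : ℕ → ℕ → ℕ} (hg : IsPile n m g) {x : ℕ × ℕ}
    (hx : StepBad g x) (k : ℕ) :
    ∑ i ∈ range n, (stepSwap x g k i : ℤ) = ∑ i ∈ range n, (g k i : ℤ) := by
  by_cases hk : k ≤ x.1
  · simp [stepSwap, hk]
  · have hlt := (stepBad_lt hg hx).2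
    have hb := stepBad_bounds hg hx k (by omega)
    rw [← sub_eq_zero, ← Finset.sum_sub_distrib, ← Finset.sum_subset (s₁ := {x.2, x.2 + 1})]
    · rw [Finset.sum_pair (by omega)]
      simp only [stepSwap, hk, if_false, if_true]
      rw [if_neg (by omega)]
      push_cast [Nat.cast_sub (show 1 ≤ g k (x.2 + 1) by omega)]
      ring
    · intro i hi
      simp only [Finset.mem_insert, Finset.mem_singleton] at hi
      rw [Finset.mem_range]
      omega
    · intro i _ hi
      simp only [Finset.mem_insert, Finset.mem_singleton, not_or] at hi
      simp [stepSwap, hk, hi.1, hi.2]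

lemma isPile_stepSwap {n m : ℕ} {g : ℕ → ℕ → ℕ} (hg : IsPile n m g) {x : ℕ × ℕ}
    (hx : StepBad g x) : IsPile n m (stepSwap x g) := by
  obtain ⟨hlt1, hlt2⟩ := stepBad_lt hg hx
  have hb := stepBad_bounds hg hx
  refine ⟨fun i => by simp [stepSwap, hg.zero], fun k i => ?_, fun k i hk => ?_, fun k i hi => ?_, ?_⟩
  · have m0 := hg.mono k i
    have m1 := hg.mono k x.2
    have m2 := hg.mono k (x.2 + 1)
    simp only [stepSwap]
    by_cases h1 : k + 1 ≤ x.1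
    · simp only [h1, show k ≤ x.1 by omega, if_true]
      exact m0
    · by_cases h2 : k ≤ x.1
      · have hk : k = x.1 := by omega
        have := hb (k + 1) (by omega)
        subst hk
        split_ifs <;> (try subst i) <;> omega
      · split_ifs <;> (try subst i) <;> omega
  · simp only [stepSwap]
    rw [hg.last k i hk, hg.last k _ hk, hg.last k _ hk, if_neg (show ¬ k ≤ x.1 by omega),
      if_neg (show ¬ n ≤ x.1 by omega)]
  · simp only [stepSwap]
    rw [if_neg (show ¬ i = x.2 by omega), if_neg (show ¬ i = x.2 + 1 by omega), ite_self]
    exact hg.supp k i hi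
  · have := sum_stepSwap hg hx n
    have h2 := hg.total
    zify at h2 ⊢
    rw [this, h2]

lemma stepBad_stepSwap {n m : ℕ} {g : ℕ → ℕ → ℕ} (hg : IsPile n m g) {x : ℕ × ℕ}
    (hx : StepBad g x) : StepBad (stepSwap x g) x := by
  have hb := stepBad_bounds hg hx
  obtain ⟨h1, h2, h3⟩ := hx
  refine ⟨fun k hk i => ?_, ?_, fun i hi => ?_⟩
  · simp only [stepSwap, show k ≤ x.1 by omega, show k + 1 ≤ x.1 by omega, if_true]
    exact h1 k hk i
  · have := hg.mono x.1 x.2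
    simp [stepSwap]
    omega
  · have := h3 i hi
    simp only [stepSwap]
    rw [if_neg (by omega), if_neg (by omega), if_neg (by omega), if_pos le_rfl]
    exact this

lemma stepSwap_stepSwap {n m : ℕ} {g : ℕ → ℕ → ℕ} (hg : IsPile n m g) {x : ℕ × ℕ}
    (hx : StepBad g x) : stepSwap x (stepSwap x g) = g := by
  have hb := stepBad_bounds hg hx
  funext k i
  by_cases hk : k ≤ x.1
  · simp [stepSwap, hk]
  · have := hb k (by omega)
    simp only [stepSwap, hk, if_false, if_true]
    split_ifs <;> (try subst i) <;> omega

lemma sum_pile {n m : ℕ} (Φ : (Fin n → ℤ) → (Fin n → ℤ) → ℚ) (hΦ : ∀ w, IsAlt fun e => Φ e w) :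
    ∑ g : Pile n m, Φ (shiftVec (vec n (g.1 n))) (wt n g.1) =
      ∑ g : Pile n m, if ∀ k i, g.1 (k + 1) (i + 1) ≤ g.1 k i then
        Φ (shiftVec (vec n (g.1 n))) (wt n g.1) else 0 := by
  rw [sum_eq_sum_of_involution (P := IsPile n m) StepBad stepSwap
    (fun g => Φ (shiftVec (vec n (g n))) (wt n g))
    (fun g x y _ => stepBad_unique) (fun g x hg hx => isPile_stepSwap hg hx)
    (fun g x hg hx => stepBad_stepSwap hg hx)
    (fun g x hg hx => stepSwap_stepSwap hg hx)]
  · refine Finset.sum_congr rfl fun g _ => ?_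
    congr 1
    apply propext
    constructor
    · intro h k i
      by_contra hc
      obtain ⟨x, hx⟩ := exists_stepBad g.2 ⟨k, i, by omega⟩
      exact h x hx
    · intro h x hx
      have := h x.1 x.2
      have := hx.2.1
      omega
  · intro g x hg hx
    have hw : wt n (stepSwap x g) = wt n g := by
      funext k
      simp only [wt, wtF, Finset.sum_sub_distrib]
      rw [sum_stepSwap hg hx, sum_stepSwap hg hx]
    obtain ⟨hlt1, hlt2⟩ := stepBad_lt hg hx
    have hb := stepBad_bounds hg hx n hlt1
    rw [hw]
    refine IsAlt.swap (hΦ _) hlt2 ?_ ?_ ?_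
    · simp only [shiftVec, vec, stepSwap]
      rw [if_neg (by omega), if_pos trivial]
      push_cast [Nat.cast_sub (show 1 ≤ g n (x.2 + 1) by omega)]
      ring
    · simp only [shiftVec, vec, stepSwap]
      rw [if_neg (by omega), if_neg (by omega), if_pos trivial]
      push_cast
      ring
    · intro j h1 h2
      simp only [shiftVec, vec, stepSwap]
      rw [if_neg (by omega), if_neg h1, if_neg h2]

/-- Extension of a matrix by zero. -/
def extMat {n : ℕ} (M : Fin n → Fin n → ℕ) (k i : ℕ) : ℕ :=
  if h : k < n ∧ i < n then M ⟨k, h.1⟩ ⟨i, h.2⟩ else 0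

/-- The partial sums of a matrix. -/
def partialSums {n : ℕ} (M : Fin n → Fin n → ℕ) (k i : ℕ) : ℕ :=
  ∑ l ∈ range k, extMat M l i

lemma partialSums_last {n : ℕ} (M : Fin n → Fin n → ℕ) (i : Fin n) :
    partialSums M n i = ∑ k, M k i := by
  simp [partialSums, Finset.sum_range, extMat]

lemma partialSums_of_le {n : ℕ} (M : Fin n → Fin n → ℕ) (k i : ℕ) (hk : n ≤ k) :
    partialSums M k i = partialSums M n i := by
  simp only [partialSums]
  symm
  apply Finset.sum_subset
  · simpa using hk
  · intro l _ hl
    simp only [Finset.mem_range] at hl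
    simp [extMat, hl]

lemma isPile_partialSums {n m : ℕ} (M : Mat n m) : IsPile n m (partialSums M.1) := by
  refine ⟨fun i => by simp [partialSums], fun k i => ?_, partialSums_of_le _, fun k i hi => ?_, ?_⟩
  · simp [partialSums, Finset.sum_range_succ]
  · simp only [partialSums, extMat]
    apply Finset.sum_eq_zero
    intro l _
    rw [dif_neg (by omega)]
  · rw [Finset.sum_range]
    simp only [partialSums_last]
    rw [Finset.sum_comm]
    exact M.2

lemma wtF_eq {n : ℕ} {g : ℕ → ℕ → ℕ} (h : ∀ k i, g k i ≤ g (k + 1) i) (k : ℕ) :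
    wtF n g k = ((∑ i ∈ range n, (g (k + 1) i - g k i) : ℕ) : ℤ) := by
  rw [wtF, Nat.cast_sum]
  exact Finset.sum_congr rfl fun i _ => by rw [Nat.cast_sub (h k i)]

/-- Matrices correspond to chains of vectors. -/
def matEquivPile (n m : ℕ) : Mat n m ≃ Pile n m where
  toFun M := ⟨partialSums M.1, isPile_partialSums M⟩
  invFun g := ⟨fun k i => g.1 (k + 1) i - g.1 k i, by
    have h : ∀ i : Fin n, ∑ k : Fin n, (g.1 (k + 1) i - g.1 k i) = g.1 n i := by
      intro i
      rw [← Finset.sum_range (fun k => g.1 (k + 1) i - g.1 k i),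
        Finset.sum_range_tsub (f := fun k => g.1 k i) (monotone_nat_of_le_succ fun k => g.2.mono k i),
        g.2.zero, Nat.sub_zero]
    rw [Finset.sum_comm]
    simp only [h]
    rw [← Finset.sum_range (fun i => g.1 n i)]
    exact g.2.total⟩
  left_inv M := by
    apply Subtype.ext
    funext k i
    simp [partialSums, Finset.sum_range_succ, extMat]
  right_inv g := by
    apply Subtype.ext
    have key : ∀ k ≤ n, ∀ i < n, partialSums (fun k i : Fin n => g.1 (k + 1) i - g.1 k i) k i
        = g.1 k i := by
      intro k hk i hi
      rw [partialSums, ← Nat.sub_zero (g.1 k i), ← g.2.zero i,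
        ← Finset.sum_range_tsub (f := fun k => g.1 k i)
          (monotone_nat_of_le_succ fun k => g.2.mono k i)]
      refine Finset.sum_congr rfl fun l hl => ?_
      rw [Finset.mem_range] at hl
      rw [extMat, dif_pos ⟨by omega, hi⟩]
    funext k i
    simp only
    by_cases hi : i < n
    · by_cases hk : k ≤ n
      · exact key k hk i hi
      · rw [partialSums_of_le _ _ _ (by omega), g.2.last k i (by omega)]
        exact key n le_rfl i hi
    · rw [g.2.supp k i (by omega)]
      exact Finset.sum_eq_zero fun l _ => by rw [extMat, dif_neg (by omega)]

/-- Chains of horizontal strips, grouped by their final shape. -/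
def pileEquivTab (n m : ℕ) :
    {g : Pile n m // ∀ k i, g.1 (k + 1) (i + 1) ≤ g.1 k i} ≃ Σ a : Shape n m, Tab n a.1 where
  toFun g :=
    have h : IsTab n (fun _ => 0) (g.1.1 n) g.1.1 :=
      ⟨g.1.2.zero, g.1.2.mono, g.1.2.last, g.2⟩
    ⟨⟨g.1.1 n, h.anti, h.supp, g.1.2.total⟩, ⟨g.1.1, h⟩⟩
  invFun x := ⟨⟨x.2.1, x.2.2.zero, x.2.2.mono,
    fun k i hk => by rw [x.2.2.last k i hk, x.2.2.last n i le_rfl],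
    fun k i hi => by
      have := x.2.2.le_last k i
      rw [x.2.2.supp i hi] at this
      omega,
    by
      refine Eq.trans ?_ x.1.2.total
      exact Finset.sum_congr rfl fun i _ => x.2.2.last n i le_rfl⟩, x.2.2.strict⟩
  left_inv g := rfl
  right_inv x := by
    obtain ⟨⟨a, ha⟩, ⟨g, hg⟩⟩ := x
    have : g n = a := funext fun i => hg.last n i le_rfl
    subst this
    rfl

/-- Iterated Pieri rule: for alternating functions, sums over matrices reduce to sums over
semistandard tableaux. -/
lemma sum_mat {n m : ℕ} (Φ : (Fin n → ℤ) → (Fin n → ℤ) → ℚ) (hΦ : ∀ w, IsAlt fun e => Φ e w) :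
    ∑ M : Mat n m, Φ (shiftVec (rowSum M.1)) (colSum M.1) =
      ∑ a : Shape n m, ∑ g : Tab n a.1, Φ (shiftVec (vec n a.1)) (wt n g.1) := by
  have h1 : ∀ M : Mat n m, Φ (shiftVec (rowSum M.1)) (colSum M.1) =
      Φ (shiftVec (vec n ((matEquivPile n m M).1 n))) (wt n (matEquivPile n m M).1) := by
    intro M
    have e1 : rowSum M.1 = vec n ((matEquivPile n m M).1 n) := by
      funext i
      simp [vec, matEquivPile, partialSums_last, rowSum]
    have e2 : colSum M.1 = wt n (matEquivPile n m M).1 := by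
      funext k
      simp [colSum, wt, wtF, matEquivPile, partialSums, Finset.sum_range_succ, Finset.sum_range,
        extMat]
    rw [e1, e2]
  simp only [h1]
  rw [Equiv.sum_comp (matEquivPile n m)
    (fun g : Pile n m => Φ (shiftVec (vec n (g.1 n))) (wt n g.1)), sum_pile Φ hΦ,
    ← Fintype.sum_sigma', ← Finset.sum_filter,
    ← Equiv.sum_comp (pileEquivTab n m), Finset.sum_subtype _ (p := fun g : Pile n m =>
      ∀ k i, g.1 (k + 1) (i + 1) ≤ g.1 k i) (by simp)]
  rfl

end

noncomputable section

/-- The amount by which the reading word of the tableau `g`, started from the content `b`,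
fails the ballot condition for the letters `x.1`, `x.1 + 1` in row `x.2`. -/
def gap (b : ℕ → ℕ) (g : ℕ → ℕ → ℕ) (x : ℕ × ℕ) : ℤ :=
  b (x.1 + 1) + wtF (x.2 + 1) g (x.1 + 1) - b x.1 - wtF x.2 g x.1

/-- The tableau given by the chain `g` is dominant relative to the shape `b`. -/
def IsDominant (b : ℕ → ℕ) (g : ℕ → ℕ → ℕ) : Prop := ∀ x, gap b g x ≤ 0

/-- The first row in which dominance fails, with the largest letter for which it fails. -/
def GapBad (b : ℕ → ℕ) (g : ℕ → ℕ → ℕ) (x : ℕ × ℕ) : Prop :=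
  (∀ i < x.2, ∀ k, gap b g (k, i) ≤ 0) ∧ 0 < gap b g x ∧ ∀ k, x.1 < k → gap b g (k, x.2) ≤ 0

/-- The row `x.1 + 1` of the Gelfand–Tsetlin pattern `g`, toggled from position `x.2` on. -/
def togRow (b : ℕ → ℕ) (x : ℕ × ℕ) (g : ℕ → ℕ → ℕ) (j : ℕ) : ℕ :=
  if j < x.2 then g (x.1 + 1) j
  else if j = x.2 then (gap b g x - 1).toNat + max (g x.1 j) (g (x.1 + 2) (j + 1))
  else max (g x.1 j) (g (x.1 + 2) (j + 1)) + min (g (x.1 + 2) j) (g x.1 (j - 1)) - g (x.1 + 1) j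

/-- The partial Bender–Knuth involution at letter `x.1` from row `x.2` on. -/
def toggle (b : ℕ → ℕ) (x : ℕ × ℕ) (g : ℕ → ℕ → ℕ) : ℕ → ℕ → ℕ := fun k j =>
  if k = x.1 + 1 then togRow b x g j else g k j

lemma wtF_succ (i : ℕ) (g : ℕ → ℕ → ℕ) (k : ℕ) :
    wtF (i + 1) g k = wtF i g k + ((g (k + 1) i : ℤ) - g k i) := by
  rw [wtF, wtF, Finset.sum_range_succ]

lemma wtF_congr {i : ℕ} {g g' : ℕ → ℕ → ℕ} {k : ℕ}
    (h : ∀ j < i, g (k + 1) j = g' (k + 1) j ∧ g k j = g' k j) : wtF i g k = wtF i g' k := by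
  refine Finset.sum_congr rfl fun j hj => ?_
  rw [(h j (Finset.mem_range.1 hj)).1, (h j (Finset.mem_range.1 hj)).2]

lemma wtF_nonneg {g : ℕ → ℕ → ℕ} (h : ∀ k i, g k i ≤ g (k + 1) i) (n k : ℕ) : 0 ≤ wtF n g k := by
  rw [wtF_eq h]
  exact Int.natCast_nonneg _

lemma gap_nonpos_of_le {n : ℕ} {a b : ℕ → ℕ} {g : ℕ → ℕ → ℕ} (hg : IsTab n (fun _ => 0) a g)
    (hb : ∀ i, n ≤ i → b i = 0) (k i : ℕ) (hk : n ≤ k + 1) : gap b g (k, i) ≤ 0 := by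
  have h1 := wtF_nonneg hg.mono i k
  have h2 : wtF (i + 1) g (k + 1) = 0 := by
    apply Finset.sum_eq_zero
    intro j _
    rw [hg.last (k + 1) j hk, hg.last (k + 1 + 1) j (by omega), sub_self]
  simp only [gap, h2, hb (k + 1) hk]
  push_cast
  omega

lemma gapBad_unique {b : ℕ → ℕ} {g : ℕ → ℕ → ℕ} {x y : ℕ × ℕ} (hx : GapBad b g x)
    (hy : GapBad b g y) : x = y := by
  obtain ⟨k, i⟩ := x
  obtain ⟨l, j⟩ := y
  obtain ⟨h1, h2, h3⟩ := hx
  obtain ⟨h1', h2', h3'⟩ := hy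
  simp only at *
  have hij : i = j := by
    rcases lt_trichotomy i j with h | h | h
    · have := h1' i h k
      omega
    · exact h
    · have := h1 j h l
      omega
  subst hij
  have hkl : k = l := by
    rcases lt_trichotomy k l with h | h | h
    · have := h3 l h
      omega
    · exact h
    · have := h3' k h
      omega
  rw [hkl]

lemma exists_gapBad {n : ℕ} {a b : ℕ → ℕ} {g : ℕ → ℕ → ℕ} (hg : IsTab n (fun _ => 0) a g)
    (hb : ∀ i, n ≤ i → b i = 0) (h : ∃ i k, 0 < gap b g (k, i)) : ∃ x, GapBad b g x := by
  have hk := Nat.find_spec h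
  set i := Nat.find h with hidef
  have hlt : ∀ i' < i, ∀ k, gap b g (k, i') ≤ 0 := by
    intro i' hi' k
    have := Nat.find_min h hi'
    push Not at this
    exact this k
  have hn : ∀ k, 0 < gap b g (k, i) → k ≤ n := by
    intro k hk
    by_contra hc
    have := gap_nonpos_of_le hg hb k i (by omega)
    omega
  obtain ⟨k0, hk0⟩ := hk
  have hspec := Nat.findGreatest_spec (P := fun k => 0 < gap b g (k, i)) (hn k0 hk0) hk0
  refine ⟨(Nat.findGreatest (fun k => 0 < gap b g (k, i)) n, i), hlt, hspec, ?_⟩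
  intro k hk
  simp only at hk ⊢
  by_contra hc
  push Not at hc
  exact Nat.findGreatest_is_greatest hk (hn k hc) hc

lemma gapBad_lt {n : ℕ} {a b : ℕ → ℕ} {g : ℕ → ℕ → ℕ} (hg : IsTab n (fun _ => 0) a g)
    (hb : ∀ i, n ≤ i → b i = 0) {x : ℕ × ℕ} (hx : GapBad b g x) : x.1 + 1 < n := by
  by_contra hc
  have := gap_nonpos_of_le hg hb x.1 x.2 (by omega)
  have := hx.2.1
  simp only [Prod.mk.eta] at *
  omega

lemma gapBad_bound {n : ℕ} {a b : ℕ → ℕ} {g : ℕ → ℕ → ℕ} (hg : IsTab n (fun _ => 0) a g)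
    (hb : ∀ i j, i ≤ j → b j ≤ b i) {x : ℕ × ℕ} (hx : GapBad b g x) :
    gap b g x + g (x.1 + 1) x.2 ≤ g (x.1 + 2) x.2 ∧
      ∀ i, x.2 = i + 1 → gap b g x + g (x.1 + 1) x.2 + g (x.1 + 1) i ≤ g (x.1 + 2) x.2 + g x.1 i := by
  obtain ⟨k, i⟩ := x
  obtain ⟨h1, h2, h3⟩ := hx
  simp only at *
  cases i with
  | zero =>
    have := hb k (k + 1) (by omega)
    refine ⟨?_, fun i hi => by omega⟩
    have h0 : ∀ k, wtF 0 g k = 0 := by simp [wtF]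
    have e : k + 1 + 1 = k + 2 := rfl
    simp only [gap, wtF_succ, h0, e, zero_add] at *
    omega
  | succ i =>
    have h4 := h1 i (by omega) k
    have m := hg.mono k i
    have : gap b g (k, i + 1) + g (k + 1) (i + 1) + g (k + 1) i ≤ g (k + 2) (i + 1) + g k i := by
      simp only [gap, wtF_succ] at *
      have e : k + 1 + 1 = k + 2 := rfl
      simp only [e] at *
      omega
    refine ⟨by omega, fun j hj => ?_⟩
    obtain rfl : i = j := by omega
    exact this

lemma togRow_bounds {n : ℕ} {a b : ℕ → ℕ} {g : ℕ → ℕ → ℕ} (hg : IsTab n (fun _ => 0) a g)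
    (hb : ∀ i j, i ≤ j → b j ≤ b i) {x : ℕ × ℕ} (hx : GapBad b g x) (j : ℕ) :
    g x.1 j ≤ togRow b x g j ∧ togRow b x g j ≤ g (x.1 + 2) j ∧
      g (x.1 + 2) (j + 1) ≤ togRow b x g j ∧ togRow b x g (j + 1) ≤ g x.1 j := by
  obtain ⟨hb1, hb2⟩ := gapBad_bound hg hb hx
  have hpos := hx.2.1
  have m1 := hg.mono x.1 j
  have m2 := hg.mono (x.1 + 1) j
  have m3 := hg.mono x.1 (j + 1)
  have m4 := hg.mono (x.1 + 1) (j + 1)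
  have s1 := hg.strict x.1 j
  have s2 := hg.strict (x.1 + 1) j
  have s3 := hg.strict x.1 (j + 1)
  have s4 := hg.strict (x.1 + 1) (j + 1)
  have s5 := hg.strict x.1 (j - 1)
  have s6 := hg.strict (x.1 + 1) (j - 1)
  have hb3 := hb2 j
  have e : x.1 + 1 + 1 = x.1 + 2 := rfl
  rw [e] at *
  rcases lt_trichotomy j x.2 with h | h | h
  · by_cases h' : j + 1 < x.2
    · simp only [togRow, h, h', if_true]
      exact ⟨m1, m2, s2, s1⟩
    · have h'' : j + 1 = x.2 := by omega
      have e1 : togRow b x g j = g (x.1 + 1) j := by rw [togRow, if_pos h]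
      have e2 : togRow b x g (j + 1) =
          (gap b g x - 1).toNat + max (g x.1 (j + 1)) (g (x.1 + 2) (j + 1 + 1)) := by
        rw [togRow, if_neg (by omega), if_pos (by omega)]
      rw [e1, e2]
      have := hb3 h''.symm
      rw [← h''] at this
      omega
  · subst h
    simp only [togRow, lt_irrefl, if_true, if_false]
    rw [if_neg (by omega), if_neg (by omega)]
    simp only [Nat.add_sub_cancel]
    omega
  · have h' : j - 1 + 1 = j := by omega
    rw [h'] at s5 s6
    simp only [togRow]
    rw [if_neg (by omega), if_neg (by omega), if_neg (by omega), if_neg (by omega)]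
    simp only [Nat.add_sub_cancel]
    omega

lemma toggle_of_ne {b : ℕ → ℕ} {x : ℕ × ℕ} {g : ℕ → ℕ → ℕ} {k : ℕ} (h : k ≠ x.1 + 1) (j : ℕ) :
    toggle b x g k j = g k j := if_neg h

lemma toggle_self {b : ℕ → ℕ} {x : ℕ × ℕ} {g : ℕ → ℕ → ℕ} (j : ℕ) :
    toggle b x g (x.1 + 1) j = togRow b x g j := if_pos rfl

lemma toggle_of_lt {b : ℕ → ℕ} {x : ℕ × ℕ} {g : ℕ → ℕ → ℕ} (k : ℕ) {j : ℕ} (h : j < x.2) :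
    toggle b x g k j = g k j := by
  by_cases hk : k = x.1 + 1
  · rw [hk, toggle_self, togRow, if_pos h]
  · exact toggle_of_ne hk j

lemma isTab_toggle {n : ℕ} {a b : ℕ → ℕ} {g : ℕ → ℕ → ℕ} (hg : IsTab n (fun _ => 0) a g)
    (hb : ∀ i j, i ≤ j → b j ≤ b i) (hb' : ∀ i, n ≤ i → b i = 0) {x : ℕ × ℕ}
    (hx : GapBad b g x) : IsTab n (fun _ => 0) a (toggle b x g) := by
  have hlt := gapBad_lt hg hb' hx
  have hbd := togRow_bounds hg hb hx
  refine ⟨fun i => ?_, fun k i => ?_, fun k i hk => ?_, fun k i => ?_⟩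
  · rw [toggle_of_ne (by omega), hg.zero]
  · by_cases h1 : k = x.1
    · subst h1
      rw [toggle_self, toggle_of_ne (by omega)]
      exact (hbd i).1
    · by_cases h2 : k = x.1 + 1
      · subst h2
        rw [toggle_self, toggle_of_ne (by omega)]
        exact (hbd i).2.1
      · rw [toggle_of_ne h2, toggle_of_ne (by omega)]
        exact hg.mono k i
  · rw [toggle_of_ne (by omega), hg.last k i hk]
  · by_cases h1 : k = x.1
    · subst h1
      rw [toggle_self, toggle_of_ne (by omega)]
      exact (hbd i).2.2.2
    · by_cases h2 : k = x.1 + 1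
      · subst h2
        rw [toggle_self, toggle_of_ne (by omega)]
        exact (hbd i).2.2.1
      · rw [toggle_of_ne h2, toggle_of_ne (by omega)]
        exact hg.strict k i

lemma gap_toggle_of_lt {b : ℕ → ℕ} {g : ℕ → ℕ → ℕ} {x : ℕ × ℕ} (k : ℕ) {i : ℕ} (hi : i < x.2) :
    gap b (toggle b x g) (k, i) = gap b g (k, i) := by
  simp only [gap]
  rw [wtF_congr (g := toggle b x g) (g' := g) (i := i + 1),
    wtF_congr (g := toggle b x g) (g' := g) (i := i)]
  · exact fun j hj => ⟨toggle_of_lt _ (by omega), toggle_of_lt _ (by omega)⟩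
  · exact fun j hj => ⟨toggle_of_lt _ (by omega), toggle_of_lt _ (by omega)⟩

lemma gap_toggle_of_gt {b : ℕ → ℕ} {g : ℕ → ℕ → ℕ} {x : ℕ × ℕ} {k : ℕ} (hk : x.1 < k) :
    gap b (toggle b x g) (k, x.2) = gap b g (k, x.2) := by
  simp only [gap]
  rw [wtF_congr (g := toggle b x g) (g' := g) (i := x.2 + 1),
    wtF_congr (g := toggle b x g) (g' := g) (i := x.2)]
  · exact fun j hj => ⟨toggle_of_lt _ (by omega), toggle_of_lt _ (by omega)⟩
  · exact fun j hj => ⟨toggle_of_ne (by omega) _, toggle_of_ne (by omega) _⟩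

lemma gap_toggle {b : ℕ → ℕ} {g : ℕ → ℕ → ℕ} {x : ℕ × ℕ}
    (hx : GapBad b g x) :
    gap b (toggle b x g) x =
      g (x.1 + 1) x.2 + 1 - max (g x.1 x.2) (g (x.1 + 2) (x.2 + 1)) := by
  have hpos := hx.2.1
  have e : x.1 + 1 + 1 = x.1 + 2 := rfl
  have h1 : wtF x.2 (toggle b x g) (x.1 + 1) = wtF x.2 g (x.1 + 1) :=
    wtF_congr fun j hj => ⟨toggle_of_lt _ hj, toggle_of_lt _ hj⟩
  have h2 : wtF x.2 (toggle b x g) x.1 = wtF x.2 g x.1 :=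
    wtF_congr fun j hj => ⟨toggle_of_lt _ hj, toggle_of_lt _ hj⟩
  have h3 : togRow b x g x.2 =
      (gap b g x - 1).toNat + max (g x.1 x.2) (g (x.1 + 2) (x.2 + 1)) := by
    simp [togRow]
  have h4 : gap b g x = b (x.1 + 1) + wtF (x.2 + 1) g (x.1 + 1) - b x.1 - wtF x.2 g x.1 := rfl
  have h5 : gap b (toggle b x g) x = b (x.1 + 1) + wtF (x.2 + 1) (toggle b x g) (x.1 + 1)
    - b x.1 - wtF x.2 (toggle b x g) x.1 := rfl
  rw [wtF_succ, h1, h2, toggle_self, toggle_of_ne (by omega), h3, e] at h5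
  rw [wtF_succ, e] at h4
  push_cast at h5
  omega

lemma gapBad_toggle {n : ℕ} {a b : ℕ → ℕ} {g : ℕ → ℕ → ℕ} (hg : IsTab n (fun _ => 0) a g)
    {x : ℕ × ℕ} (hx : GapBad b g x) : GapBad b (toggle b x g) x := by
  refine ⟨fun i hi k => ?_, ?_, fun k hk => ?_⟩
  · rw [gap_toggle_of_lt k hi]
    exact hx.1 i hi k
  · rw [gap_toggle hx]
    have := hg.mono x.1 x.2
    have := hg.strict (x.1 + 1) x.2
    have e : x.1 + 1 + 1 = x.1 + 2 := rfl
    rw [e] at *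
    omega
  · rw [gap_toggle_of_gt hk]
    exact hx.2.2 k hk

lemma toggle_toggle {n : ℕ} {a b : ℕ → ℕ} {g : ℕ → ℕ → ℕ} (hg : IsTab n (fun _ => 0) a g)
    {x : ℕ × ℕ} (hx : GapBad b g x) : toggle b x (toggle b x g) = g := by
  have hgap := gap_toggle hx
  funext k j
  by_cases hk : k = x.1 + 1
  · subst hk
    rw [toggle_self]
    have m1 := hg.mono x.1 j
    have m2 := hg.mono (x.1 + 1) j
    have s2 := hg.strict (x.1 + 1) j
    have s5 := hg.strict x.1 (j - 1)
    have e : x.1 + 1 + 1 = x.1 + 2 := rfl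
    rw [e] at *
    rcases lt_trichotomy j x.2 with h | h | h
    · rw [togRow, if_pos h, toggle_self, togRow, if_pos h]
    · subst h
      rw [togRow, if_neg (by omega), if_pos rfl, hgap, toggle_of_ne (by omega),
        toggle_of_ne (by omega)]
      omega
    · have h' : j - 1 + 1 = j := by omega
      rw [h'] at s5
      rw [togRow, if_neg (by omega), if_neg (by omega), toggle_self, toggle_of_ne (by omega),
        toggle_of_ne (by omega), toggle_of_ne (by omega), toggle_of_ne (by omega), togRow,
        if_neg (by omega), if_neg (by omega)]
      omega
  · rw [toggle_of_ne hk, toggle_of_ne hk]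

lemma sum_togRow {n : ℕ} {a b : ℕ → ℕ} {g : ℕ → ℕ → ℕ} (hg : IsTab n (fun _ => 0) a g)
    {x : ℕ × ℕ} (hx : GapBad b g x) (N : ℕ) :
    ∑ j ∈ range (x.2 + 1 + N), ((togRow b x g j : ℤ) - g x.1 j) =
      b (x.1 + 1) - b x.1 - 1 + wtF (x.2 + 1 + N) g (x.1 + 1) +
        (max (g x.1 (x.2 + N)) (g (x.1 + 2) (x.2 + 1 + N)) - g x.1 (x.2 + N)) := by
  have hpos := hx.2.1
  have e : x.1 + 1 + 1 = x.1 + 2 := rfl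
  induction N with
  | zero =>
    have h2 : ∑ j ∈ range x.2, ((togRow b x g j : ℤ) - g x.1 j) = wtF x.2 g x.1 :=
      Finset.sum_congr rfl fun j hj => by
        rw [togRow, if_pos (Finset.mem_range.1 hj)]
    have h3 : togRow b x g x.2 =
        (gap b g x - 1).toNat + max (g x.1 x.2) (g (x.1 + 2) (x.2 + 1)) := by
      simp [togRow]
    have h4 : gap b g x = b (x.1 + 1) + wtF (x.2 + 1) g (x.1 + 1) - b x.1 - wtF x.2 g x.1 := rfl
    simp only [Nat.add_zero]
    rw [Finset.sum_range_succ, h2, h3]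
    push_cast
    omega
  | succ N ih =>
    have m1 := hg.mono x.1 (x.2 + 1 + N)
    have m2 := hg.mono (x.1 + 1) (x.2 + 1 + N)
    have s2 := hg.strict (x.1 + 1) (x.2 + 1 + N)
    have s5 := hg.strict x.1 (x.2 + N)
    have h3 : togRow b x g (x.2 + 1 + N) =
        max (g x.1 (x.2 + 1 + N)) (g (x.1 + 2) (x.2 + 1 + N + 1)) +
          min (g (x.1 + 2) (x.2 + 1 + N)) (g x.1 (x.2 + N)) - g (x.1 + 1) (x.2 + 1 + N) := by
      rw [togRow, if_neg (by omega), if_neg (by omega)]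
      have : x.2 + 1 + N - 1 = x.2 + N := by omega
      rw [this]
    have e1 : x.2 + (N + 1) = x.2 + 1 + N := by omega
    have e2 : x.2 + 1 + (N + 1) = x.2 + 1 + N + 1 := by omega
    have e3 : x.2 + N + 1 = x.2 + 1 + N := by omega
    rw [e3] at s5
    rw [e1, e2, Finset.sum_range_succ, ih, h3, wtF_succ]
    rw [e] at *
    omega

lemma wt_toggle {n : ℕ} {a b : ℕ → ℕ} {g : ℕ → ℕ → ℕ} (hg : IsTab n (fun _ => 0) a g)
    (hb : ∀ i j, i ≤ j → b j ≤ b i) (hb' : ∀ i, n ≤ i → b i = 0) {x : ℕ × ℕ}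
    (hx : GapBad b g x) :
    (b x.1 + wtF n (toggle b x g) x.1 = b (x.1 + 1) + wtF n g (x.1 + 1) - 1) ∧
    (b (x.1 + 1) + wtF n (toggle b x g) (x.1 + 1) = b x.1 + wtF n g x.1 + 1) ∧
    ∀ k, k ≠ x.1 → k ≠ x.1 + 1 → wtF n (toggle b x g) k = wtF n g k := by
  have hlt := gapBad_lt hg hb' hx
  have hi : x.2 < n := by
    by_contra hc
    have h1 := (gapBad_bound hg hb hx).1
    have h2 := hx.2.1
    have h3 := hg.le_last (x.1 + 2) x.2
    rw [hg.supp x.2 (by omega)] at h3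
    omega
  have h1 : wtF n (toggle b x g) x.1 =
      b (x.1 + 1) - b x.1 - 1 + wtF n g (x.1 + 1) := by
    have := sum_togRow hg hx (n - x.2 - 1)
    have h3 := hg.le_last (x.1 + 2) n
    rw [hg.supp n le_rfl] at h3
    rw [show x.2 + 1 + (n - x.2 - 1) = n by omega] at this
    rw [wtF]
    simp only [toggle_self, toggle_of_ne (show x.1 ≠ x.1 + 1 by omega)]
    rw [this]
    omega
  have h2 : wtF n (toggle b x g) x.1 + wtF n (toggle b x g) (x.1 + 1) =
      wtF n g x.1 + wtF n g (x.1 + 1) := by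
    simp only [wtF, ← Finset.sum_add_distrib]
    refine Finset.sum_congr rfl fun j _ => ?_
    rw [toggle_of_ne (k := x.1 + 1 + 1) (by omega), toggle_of_ne (k := x.1) (by omega)]
    ring
  refine ⟨by omega, by omega, fun k h3 h4 => ?_⟩
  exact wtF_congr fun j _ => ⟨toggle_of_ne (by omega) _, toggle_of_ne (by omega) _⟩

/-- Cancellation of the non-dominant tableaux. -/
lemma sum_tab {n m : ℕ} {A : (Fin n → ℤ) → ℚ} (hA : IsAlt A) (a : ℕ → ℕ) {b : ℕ → ℕ}
    (hb : IsShape n m b) :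
    ∑ g : Tab n a, A (shiftVec (vec n b + wt n g.1)) =
      ∑ g : Tab n a, if IsDominant b g.1 then A (shiftVec (vec n b + wt n g.1)) else 0 := by
  rw [sum_eq_sum_of_involution (P := IsTab n (fun _ => 0) a) (GapBad b) (toggle b)
    (fun g => A (shiftVec (vec n b + wt n g)))
    (fun g x y _ => gapBad_unique) (fun g x hg hx => isTab_toggle hg hb.anti hb.supp hx)
    (fun g x hg hx => gapBad_toggle hg hx) (fun g x hg hx => toggle_toggle hg hx)]
  · refine Finset.sum_congr rfl fun g _ => ?_
    congr 1
    apply propext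
    constructor
    · intro h x
      by_contra hc
      obtain ⟨x, hx⟩ := exists_gapBad g.2 hb.supp ⟨x.2, x.1, by push Not at hc; exact hc⟩
      exact h x hx
    · intro h x hx
      have := h x
      have := hx.2.1
      omega
  · intro g x hg hx
    have hlt := gapBad_lt hg hb.supp hx
    obtain ⟨h1, h2, h3⟩ := wt_toggle hg hb.anti hb.supp hx
    refine IsAlt.swap hA hlt ?_ ?_ ?_
    · simp only [shiftVec, vec, wt, Pi.add_apply]
      rw [h1]
      push_cast
      ring
    · simp only [shiftVec, vec, wt, Pi.add_apply]
      rw [h2]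
      push_cast
      ring
    · intro j hj hj'
      simp only [shiftVec, vec, wt, Pi.add_apply]
      rw [h3 j hj hj']

end

noncomputable section

/-- The antisymmetrization of the indicator of the shifted vector of `a`. -/
def altDelta {n : ℕ} (a : ℕ → ℕ) (e : Fin n → ℤ) : ℚ :=
  ∑ σ : Perm (Fin n), ((Perm.sign σ : ℤ) : ℚ) * if e = shiftVec (vec n a) ∘ σ then 1 else 0

lemma isAlt_altDelta {n : ℕ} (a : ℕ → ℕ) : IsAlt (altDelta (n := n) a) := by
  intro τ e
  simp only [altDelta, Finset.mul_sum]
  refine Fintype.sum_equiv (Equiv.mulRight τ⁻¹) _ _ fun σ => ?_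
  have h1 : ((Perm.sign τ : ℤ) : ℚ) * ((Perm.sign τ : ℤ) : ℚ) = 1 := by
    rw [← Int.cast_mul, Int.units_coe_mul_self, Int.cast_one]
  have h2 : (e ∘ τ = shiftVec (vec n a) ∘ σ) ↔ e = shiftVec (vec n a) ∘ (σ * τ⁻¹) := by
    constructor
    · intro h
      funext i
      have := congrFun h (τ⁻¹ i)
      simpa using this
    · intro h
      rw [h]
      funext i
      simp
  have h3 : ((Perm.sign σ : ℤ) : ℚ) =
      ((Perm.sign τ : ℤ) : ℚ) * ((Perm.sign (Equiv.mulRight τ⁻¹ σ) : ℤ) : ℚ) := by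
    simp only [Equiv.coe_mulRight, Perm.sign_mul, Perm.sign_inv, Units.val_mul, Int.cast_mul]
    rw [mul_left_comm, h1, mul_one]
  rw [h3, mul_assoc, Equiv.coe_mulRight]
  exact congrArg _ (congrArg _ (if_congr h2 rfl rfl))

lemma strictAnti_shiftVec {n : ℕ} {a : ℕ → ℕ} (ha : ∀ i j, i ≤ j → a j ≤ a i) :
    StrictAnti (shiftVec (vec n a)) := by
  intro i j hij
  have := ha i j hij.le
  have : (i : ℕ) < j := hij
  simp only [shiftVec, vec]
  omega

lemma perm_eq_one_of_monotone {n : ℕ} {σ : Perm (Fin n)} (h : Monotone σ) : σ = 1 := by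
  have h' : StrictMono σ := h.strictMono_of_injective σ.injective
  ext i
  exact congrArg Fin.val (congrFun ((StrictMono.range_inj h' strictMono_id).1 (by
    rw [σ.surjective.range_eq, Set.range_id])) i)

lemma shape_ext {n m m' : ℕ} {a b : ℕ → ℕ} (ha : IsShape n m a) (hb : IsShape n m' b)
    (h : vec n a = vec n b) : a = b := by
  funext i
  by_cases hi : i < n
  · have := congrFun h ⟨i, hi⟩
    simpa [vec] using this
  · rw [ha.supp i (by omega), hb.supp i (by omega)]

lemma altDelta_shape {n m m' : ℕ} {a b : ℕ → ℕ} (ha : IsShape n m a) (hb : IsShape n m' b) :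
    altDelta a (shiftVec (vec n b)) = if a = b then 1 else 0 := by
  have key : ∀ σ : Perm (Fin n), shiftVec (vec n b) = shiftVec (vec n a) ∘ σ ↔ a = b ∧ σ = 1 := by
    intro σ
    constructor
    · intro h
      have hσ : σ = 1 := by
        apply perm_eq_one_of_monotone
        intro i j hij
        have h1 := (strictAnti_shiftVec (n := n) hb.anti).antitone hij
        rw [h] at h1
        exact (strictAnti_shiftVec (n := n) ha.anti).le_iff_ge.1 h1
      subst hσ
      refine ⟨shape_ext ha hb ?_, rfl⟩
      funext i
      have := congrFun h i
      simp only [shiftVec, Function.comp, Perm.coe_one, id] at this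
      omega
    · rintro ⟨rfl, rfl⟩
      rfl
  simp only [altDelta, key]
  by_cases hab : a = b <;> simp [hab]

/-- The tableau of shape `a` all of whose entries in row `i` are `i`. -/
def superTab (a : ℕ → ℕ) (k i : ℕ) : ℕ := if i < k then a i else 0

lemma isTab_superTab {n m : ℕ} {a : ℕ → ℕ} (ha : IsShape n m a) :
    IsTab n (fun _ => 0) a (superTab a) := by
  refine ⟨fun i => by simp [superTab], fun k i => ?_, fun k i hk => ?_, fun k i => ?_⟩
  · simp only [superTab]
    split_ifs <;> omega
  · simp only [superTab]
    split_ifs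
    · rfl
    · rw [ha.supp i (by omega)]
  · have := ha.anti i (i + 1) (by omega)
    simp only [superTab]
    split_ifs <;> omega

lemma wtF_superTab (a : ℕ → ℕ) (i k : ℕ) :
    wtF i (superTab a) k = if k < i then (a k : ℤ) else 0 := by
  induction i with
  | zero => simp [wtF]
  | succ i ih =>
    rw [wtF_succ, ih]
    simp only [superTab]
    rcases lt_trichotomy k i with h | h | h
    · rw [if_pos h, if_neg (by omega), if_neg (by omega), if_pos (by omega)]
      simp
    · subst h
      simp
    · rw [if_neg (by omega), if_pos (by omega), if_pos (by omega), if_neg (by omega)]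
      simp

lemma isDominant_superTab {n m : ℕ} {a : ℕ → ℕ} (ha : IsShape n m a) :
    IsDominant (fun _ => 0) (superTab a) := by
  rintro ⟨k, i⟩
  have := ha.anti k (k + 1) (by omega)
  simp only [gap, wtF_superTab]
  split_ifs <;> push_cast <;> omega

lemma eq_superTab {n : ℕ} {a : ℕ → ℕ} {g : ℕ → ℕ → ℕ} (hg : IsTab n (fun _ => 0) a g)
    (hd : IsDominant (fun _ => 0) g) : g = superTab a := by
  have key : ∀ i k, i ≤ k → wtF i g k = 0 := by
    intro i
    induction i with
    | zero => simp [wtF]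
    | succ i ih =>
      intro k hk
      obtain ⟨l, rfl⟩ : ∃ l, k = l + 1 := ⟨k - 1, by omega⟩
      have h1 := hd (l, i)
      simp only [gap, ih l (by omega)] at h1
      have h2 := wtF_nonneg hg.mono (i + 1) (l + 1)
      push_cast at h1
      omega
  have step : ∀ i k, i < k → g (k + 1) i = g k i := by
    intro i k hk
    have h1 := key (i + 1) k hk
    rw [wtF_succ, key i k hk.le] at h1
    omega
  have const : ∀ i k N, i < k → g (k + N) i = g k i := by
    intro i k N hk
    induction N with
    | zero => rfl
    | succ N ih => rw [← add_assoc, step i (k + N) (by omega), ih]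
  funext k i
  simp only [superTab]
  split_ifs with h
  · rw [← const i k n h, hg.last _ i (by omega)]
  · exact hg.eq_zero k i (by omega)

lemma isShape_zero (n : ℕ) : IsShape n 0 (fun _ => 0) :=
  ⟨fun _ _ _ => le_rfl, fun _ _ => rfl, by simp⟩

/-- Only the superstandard tableau survives in an alternating sum over tableaux. -/
lemma sum_tab_zero {n m : ℕ} {A : (Fin n → ℤ) → ℚ} (hA : IsAlt A) {a : ℕ → ℕ}
    (ha : IsShape n m a) : ∑ g : Tab n a, A (shiftVec (wt n g.1)) = A (shiftVec (vec n a)) := by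
  have h := sum_tab hA a (isShape_zero n)
  have h0 : vec n (fun _ => 0) = 0 := by
    funext i
    simp [vec]
  simp only [h0, zero_add] at h
  rw [h, Finset.sum_eq_single (⟨superTab a, isTab_superTab ha⟩ : Tab n a)]
  · rw [if_pos (isDominant_superTab ha)]
    congr 2
    funext i
    simp [wt, wtF_superTab, vec]
  · intro g _ hne
    rw [if_neg]
    intro hd
    exact hne (Subtype.ext (eq_superTab g.2 hd))
  · simp

/-- The distribution of the statistic `f` is invariant under permutation of coordinates. -/
def IsSym {S : Type*} [Fintype S] {n : ℕ} (f : S → Fin n → ℤ) : Prop :=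
  ∀ (π : Perm (Fin n)) (F : (Fin n → ℤ) → ℚ), ∑ s, F (f s ∘ π) = ∑ s, F (f s)

lemma sum_mat_altDelta {n m : ℕ} {a : ℕ → ℕ} (ha : IsShape n m a) (F : (Fin n → ℤ) → ℚ) :
    ∑ M : Mat n m, altDelta a (shiftVec (rowSum M.1)) * F (colSum M.1) =
      ∑ g : Tab n a, F (wt n g.1) := by
  rw [sum_mat (fun e w => altDelta a e * F w)]
  · rw [Finset.sum_eq_single (⟨a, ha⟩ : Shape n m)]
    · refine Finset.sum_congr rfl fun g _ => ?_
      rw [altDelta_shape ha ha, if_pos rfl, one_mul]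
    · intro b _ hb
      refine Finset.sum_eq_zero fun g _ => ?_
      rw [altDelta_shape ha b.2, if_neg, zero_mul]
      exact fun h => hb (Subtype.ext h.symm)
    · simp
  · intro w σ e
    simp only
    rw [isAlt_altDelta, mul_assoc]

/-- Permutation of the rows of a matrix. -/
def matPerm (n m : ℕ) (π : Perm (Fin n)) : Mat n m ≃ Mat n m where
  toFun M := ⟨fun k => M.1 (π k), by
    rw [Equiv.sum_comp π (fun k => ∑ i, M.1 k i)]
    exact M.2⟩
  invFun M := ⟨fun k => M.1 (π⁻¹ k), by
    rw [Equiv.sum_comp π⁻¹ (fun k => ∑ i, M.1 k i)]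
    exact M.2⟩
  left_inv M := by simp
  right_inv M := by simp

lemma isSym_wt {n m : ℕ} {a : ℕ → ℕ} (ha : IsShape n m a) :
    IsSym (fun g : Tab n a => wt n g.1) := by
  intro π F
  rw [← sum_mat_altDelta ha F, ← sum_mat_altDelta ha (fun w => F (w ∘ π))]
  refine Fintype.sum_equiv (matPerm n m π) _ _ fun M => ?_
  have h1 : rowSum (matPerm n m π M).1 = rowSum M.1 := by
    funext i
    exact Equiv.sum_comp π (fun k => (M.1 k i : ℤ))
  rw [h1]
  rfl

lemma sum_wt {n : ℕ} {a : ℕ → ℕ} {g : ℕ → ℕ → ℕ} (hg : IsTab n (fun _ => 0) a g) :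
    ∑ k, wt n g k = ∑ i ∈ range n, (a i : ℤ) := by
  simp only [wt, wtF]
  rw [← Finset.sum_range (fun k => ∑ i ∈ range n, ((g (k + 1) i : ℤ) - g k i)), Finset.sum_comm]
  refine Finset.sum_congr rfl fun i _ => ?_
  rw [Finset.sum_range_sub (fun k => (g k i : ℤ)), hg.zero, hg.last n i le_rfl]
  simp

lemma wt_nonneg {n : ℕ} {a : ℕ → ℕ} {g : ℕ → ℕ → ℕ} (hg : IsTab n (fun _ => 0) a g) (k : Fin n) :
    0 ≤ wt n g k := wtF_nonneg hg.mono n k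

/-- The multiplicity of the shape `a` in the distribution of `f`. -/
def mult {S : Type*} [Fintype S] {n : ℕ} (f : S → Fin n → ℤ) (a : ℕ → ℕ) : ℚ :=
  ∑ s, altDelta a (shiftVec (f s))

lemma IsSym.alternating_sum {S : Type*} [Fintype S] {n : ℕ} {f : S → Fin n → ℤ} (hf : IsSym f)
    (a : ℕ → ℕ) :
    ∑ σ : Perm (Fin n), ((Perm.sign σ : ℤ) : ℚ) *
      ∑ s, (if f s = fun i : Fin n => (a i : ℤ) - (i : ℕ) + (σ i : ℕ) then (1 : ℚ) else 0) =
      mult f a := by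
  simp only [mult, altDelta]
  rw [Finset.sum_comm]
  simp only [← Finset.mul_sum]
  refine Fintype.sum_equiv (Equiv.inv _) _ _ fun σ => ?_
  simp only [Equiv.inv_apply, Perm.sign_inv]
  congr 1
  rw [← hf σ⁻¹ (fun v => if shiftVec v = shiftVec (vec n a) ∘ (σ⁻¹ : Perm (Fin n)) then (1 : ℚ)
    else 0)]
  refine Finset.sum_congr rfl fun s _ => ?_
  refine if_congr ?_ rfl rfl
  constructor
  · intro h
    rw [h]
    funext i
    simp [shiftVec, vec]
  · intro h
    funext i
    have := congrFun h (σ i)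
    simp [shiftVec, vec] at this
    omega

lemma eq_zero_of_alternating_sums {n m : ℕ} (ψ : (Fin n → ℤ) → ℚ) (C : Finset (Fin n → ℤ))
    (hsym : ∀ (π : Perm (Fin n)) c, ψ (c ∘ π) = ψ c) (hC : ∀ c, ψ c ≠ 0 → c ∈ C)
    (hpos : ∀ c, ψ c ≠ 0 → ∀ i, 0 ≤ c i) (htot : ∀ c, ψ c ≠ 0 → ∑ i, c i = m)
    (halt : ∀ a : Shape n m, ∑ σ : Perm (Fin n), ((Perm.sign σ : ℤ) : ℚ) *
      ψ (fun i : Fin n => (a.1 i : ℤ) - (i : ℕ) + (σ i : ℕ)) = 0) (c : Fin n → ℤ) : ψ c = 0 := by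
  by_contra hc
  obtain ⟨d, hd, hmax⟩ := Finset.exists_max_image (C.filter fun c => ψ c ≠ 0)
    (fun c => ∑ i, c i ^ 2) ⟨c, Finset.mem_filter.2 ⟨hC c hc, hc⟩⟩
  have hd := (Finset.mem_filter.1 hd).2
  obtain ⟨e, he0, he1, heq⟩ : ∃ e : Fin n → ℤ, Antitone e ∧ ψ e ≠ 0 ∧
      ∑ i, e i ^ 2 = ∑ i, d i ^ 2 := by
    refine ⟨d ∘ (Tuple.sort (fun i => - d i)), ?_, ?_, ?_⟩
    · intro i j hij
      have := Tuple.monotone_sort (fun i => - d i) hij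
      simp only [Function.comp] at this ⊢
      omega
    · rwa [hsym]
    · exact Equiv.sum_comp (Tuple.sort (fun i => - d i)) (fun i => d i ^ 2)
  have hshape : IsShape n m (fun i => if h : i < n then (e ⟨i, h⟩).toNat else 0) := by
    refine ⟨fun i j hij => ?_, fun i hi => ?_, ?_⟩
    · by_cases hj : j < n
      · have := he0 (show (⟨i, by omega⟩ : Fin n) ≤ ⟨j, hj⟩ from hij)
        simp only [hj, show i < n by omega, dif_pos]
        omega
      · simp [hj]
    · simp [show ¬ i < n by omega]
    · have := htot e he1
      zify
      rw [← this, Finset.sum_range]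
      refine Finset.sum_congr rfl fun i _ => ?_
      have := hpos e he1 i
      simp [this]
  have hval : vec n (fun i => if h : i < n then (e ⟨i, h⟩).toNat else 0) = e := by
    funext i
    have := hpos e he1 i
    simp [vec, this]
  have hsum := halt ⟨_, hshape⟩
  rw [Finset.sum_eq_single 1] at hsum
  · simp only [Perm.sign_one, Units.val_one, Int.cast_one, one_mul, Perm.coe_one, id,
      sub_add_cancel] at hsum
    exact he1 (by rw [← hval]; exact hsum)
  · intro σ _ hσ
    by_contra hne
    have h1 : ψ (fun i => e i - (i : ℕ) + (σ i : ℕ)) ≠ 0 := by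
      intro h0
      apply hne
      have : (fun i : Fin n => (((if h : (i : ℕ) < n then (e ⟨i, h⟩).toNat else 0 : ℕ) : ℤ)
          - (i : ℕ) + (σ i : ℕ))) = fun i => e i - (i : ℕ) + (σ i : ℕ) := by
        funext i
        have := hpos e he1 i
        simp [this]
      rw [this, h0, mul_zero]
    have h2 := hmax _ (Finset.mem_filter.2 ⟨hC _ h1, h1⟩)
    have hanti : StrictAnti (fun i : Fin n => e i - (i : ℕ)) := by
      intro i j hij
      have h3 := he0 hij.le
      have : (i : ℕ) < j := hij
      simp only
      omega
    have h3 : ∑ i, (e i - (i : ℕ)) * ((i : ℕ) : ℤ) < ∑ i, (e i - (i : ℕ)) * ((σ i : ℕ) : ℤ) := by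
      have hav : Antivary (fun i : Fin n => e i - (i : ℕ)) (fun i : Fin n => ((i : ℕ) : ℤ)) := by
        intro i j hij
        have : i < j := by
          rw [Fin.lt_def]
          simpa using hij
        exact (hanti this).le
      refine hav.sum_mul_lt_sum_mul_comp_perm_iff.2 fun hav' => hσ ?_
      apply perm_eq_one_of_monotone
      intro i j hij
      by_contra hlt
      push Not at hlt
      have h4 := hav' (i := j) (j := i) (by simpa using hlt)
      have h5 : i ≠ j := fun h => by simp [h] at hlt
      have h6 := hanti (lt_of_le_of_ne hij h5)
      exact absurd h4 (not_le.2 h6)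
    have h4 : ∑ i, ((σ i : ℕ) : ℤ) ^ 2 = ∑ i : Fin n, ((i : ℕ) : ℤ) ^ 2 :=
      Equiv.sum_comp σ (fun i : Fin n => ((i : ℕ) : ℤ) ^ 2)
    have h5 : ∑ i, (e i - (i : ℕ) + (σ i : ℕ)) ^ 2 = ∑ i, (e i - (i : ℕ)) ^ 2 +
        2 * ∑ i, (e i - (i : ℕ)) * ((σ i : ℕ) : ℤ) + ∑ i, ((σ i : ℕ) : ℤ) ^ 2 := by
      rw [Finset.mul_sum, ← Finset.sum_add_distrib, ← Finset.sum_add_distrib]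
      exact Finset.sum_congr rfl fun i _ => by ring
    have h6 : ∑ i, (e i) ^ 2 = ∑ i, (e i - (i : ℕ)) ^ 2 +
        2 * ∑ i, (e i - (i : ℕ)) * ((i : ℕ) : ℤ) + ∑ i : Fin n, ((i : ℕ) : ℤ) ^ 2 := by
      rw [Finset.mul_sum, ← Finset.sum_add_distrib, ← Finset.sum_add_distrib]
      exact Finset.sum_congr rfl fun i _ => by ring
    linarith
  · simp

/-- A symmetric distribution is a combination of the distributions of tableaux contents. -/
lemma IsSym.sum_eq {S : Type*} [Fintype S] {n m : ℕ} {f : S → Fin n → ℤ} (hf : IsSym f)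
    (hpos : ∀ s i, 0 ≤ f s i) (htot : ∀ s, ∑ i, f s i = m) (F : (Fin n → ℤ) → ℚ) :
    ∑ s, F (f s) = ∑ a : Shape n m, mult f a.1 * ∑ g : Tab n a.1, F (wt n g.1) := by
  set ψ : (Fin n → ℤ) → ℚ := fun c => ∑ s, (if f s = c then (1 : ℚ) else 0) -
    ∑ a : Shape n m, mult f a.1 * ∑ g : Tab n a.1, if wt n g.1 = c then (1 : ℚ) else 0 with hψ
  have hcomp : ∀ (π : Perm (Fin n)) (v c : Fin n → ℤ), v = c ∘ π ↔ v ∘ (π⁻¹ : Perm (Fin n)) = c := by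
    intro π v c
    constructor
    · rintro rfl
      funext i
      simp
    · rintro rfl
      funext i
      simp
  have hsupp : ∀ c, ψ c ≠ 0 → (∃ s, f s = c) ∨ ∃ (a : Shape n m) (g : Tab n a.1), wt n g.1 = c := by
    intro c hc
    by_contra hcon
    push Not at hcon
    apply hc
    simp only [hψ]
    rw [Finset.sum_eq_zero fun s _ => if_neg (hcon.1 s), Finset.sum_eq_zero, sub_zero]
    intro a _
    rw [Finset.sum_eq_zero fun g _ => if_neg (hcon.2 a g), mul_zero]
  have hzero : ∀ c, ψ c = 0 := by
    apply eq_zero_of_alternating_sums (m := m) ψ (univ.image f ∪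
      univ.image fun x : Σ a : Shape n m, Tab n a.1 => wt n x.2.1)
    · intro π c
      simp only [hψ, hcomp]
      rw [hf π⁻¹ (fun v => if v = c then 1 else 0)]
      congr 1
      refine Finset.sum_congr rfl fun a _ => ?_
      rw [isSym_wt a.2 π⁻¹ (fun v => if v = c then 1 else 0)]
    · intro c hc
      rcases hsupp c hc with ⟨s, rfl⟩ | ⟨a, g, rfl⟩
      · simp
      · exact Finset.mem_union_right _ (Finset.mem_image.2 ⟨⟨a, g⟩, by simp, rfl⟩)
    · intro c hc
      rcases hsupp c hc with ⟨s, rfl⟩ | ⟨a, g, rfl⟩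
      · exact hpos s
      · exact wt_nonneg g.2
    · intro c hc
      rcases hsupp c hc with ⟨s, rfl⟩ | ⟨a, g, rfl⟩
      · exact htot s
      · rw [sum_wt g.2]
        exact_mod_cast a.2.total
    · intro a
      simp only [hψ, mul_sub, Finset.sum_sub_distrib, hf.alternating_sum]
      simp only [Finset.mul_sum (s := (univ : Finset (Shape n m))), mul_left_comm]
      rw [Finset.sum_comm]
      simp only [← Finset.mul_sum (s := (univ : Finset (Perm (Fin n))))]
      have : ∀ b : Shape n m, mult (fun g : Tab n b.1 => wt n g.1) a.1 =
          if a = b then 1 else 0 := by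
        intro b
        rw [mult, sum_tab_zero (isAlt_altDelta a.1) b.2, altDelta_shape a.2 b.2]
        simp only [Subtype.ext_iff]
      simp only [(isSym_wt (Subtype.prop _)).alternating_sum, this]
      simp
  have hF : ∀ v ∈ univ.image f ∪ univ.image (fun x : Σ a : Shape n m, Tab n a.1 => wt n x.2.1),
      F v = ∑ c ∈ univ.image f ∪ univ.image (fun x : Σ a : Shape n m, Tab n a.1 => wt n x.2.1),
        F c * if v = c then 1 else 0 := by
    intro v hv
    simp [hv]
  rw [Finset.sum_congr rfl fun s _ => hF (f s) (by simp), Finset.sum_comm]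
  have hF' : ∀ a : Shape n m, ∑ g : Tab n a.1, F (wt n g.1) =
      ∑ c ∈ univ.image f ∪ univ.image (fun x : Σ a : Shape n m, Tab n a.1 => wt n x.2.1),
        F c * ∑ g : Tab n a.1, if wt n g.1 = c then 1 else 0 := by
    intro a
    rw [Finset.sum_congr rfl fun g _ => hF (wt n g.1)
      (Finset.mem_union_right _ (Finset.mem_image.2 ⟨⟨a, g⟩, by simp, rfl⟩)), Finset.sum_comm]
    simp only [Finset.mul_sum]
  simp only [hF', Finset.mul_sum (s := (_ ∪ _))]
  rw [Finset.sum_comm (s := (univ : Finset (Shape n m)))]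
  refine Finset.sum_congr rfl fun c _ => ?_
  rw [← Finset.mul_sum, sub_eq_zero.1 (hzero c), Finset.mul_sum]
  exact Finset.sum_congr rfl fun a _ => by ring

end

noncomputable section

lemma exists_equiv_of_sum_eq {S T V : Type*} [Fintype S] [Fintype T] (f : S → V) (g : T → V)
    (h : ∀ v, ∑ s, (if f s = v then (1 : ℚ) else 0) = ∑ t, if g t = v then (1 : ℚ) else 0) :
    ∃ e : S ≃ T, ∀ s, f s = g (e s) := by
  have hcard : ∀ v, Fintype.card {s // f s = v} = Fintype.card {t // g t = v} := by
    intro v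
    have := h v
    simp only [Finset.sum_boole] at this
    rw [Fintype.card_subtype, Fintype.card_subtype]
    exact_mod_cast this
  exact ⟨Equiv.ofFiberEquiv fun v => Fintype.equivOfCardEq (hcard v),
    fun s => (Equiv.ofFiberEquiv_map _ s).symm⟩

/-- Permutation of the columns of a matrix. -/
def matPermCol (n m : ℕ) (π : Perm (Fin n)) : Mat n m ≃ Mat n m where
  toFun M := ⟨fun k i => M.1 k (π i), by
    simp only [fun k => Equiv.sum_comp π (fun i => M.1 k i)]
    exact M.2⟩
  invFun M := ⟨fun k i => M.1 k (π⁻¹ i), by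
    simp only [fun k => Equiv.sum_comp π⁻¹ (fun i => M.1 k i)]
    exact M.2⟩
  left_inv M := by simp
  right_inv M := by simp

lemma colSum_matPermCol {n m : ℕ} (π : Perm (Fin n)) (M : Mat n m) :
    colSum (matPermCol n m π M).1 = colSum M.1 := by
  funext k
  exact Equiv.sum_comp π (fun i => (M.1 k i : ℤ))

lemma isSym_rowSum (n m : ℕ) (b : Fin n → ℤ) :
    IsSym (fun M : {M : Mat n m // colSum M.1 = b} => rowSum M.1.1) := by
  intro π F
  refine Fintype.sum_equiv ((matPermCol n m π).subtypeEquiv fun M => ?_) _ _ fun M => rfl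
  rw [colSum_matPermCol]

lemma sum_mat_pair {n m : ℕ} (c b : Fin n → ℤ) :
    ∑ M : Mat n m, (if (rowSum M.1, colSum M.1) = (c, b) then (1 : ℚ) else 0) =
      ∑ x : Σ a : Shape n m, Tab n a.1 × Tab n a.1,
        if (wt n x.2.1.1, wt n x.2.2.1) = (c, b) then (1 : ℚ) else 0 := by
  have h1 : ∀ M : Mat n m, (if (rowSum M.1, colSum M.1) = (c, b) then (1 : ℚ) else 0) =
      if colSum M.1 = b then (if rowSum M.1 = c then 1 else 0) else 0 := by
    intro M
    rw [← ite_and]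
    simp only [Prod.mk.injEq, and_comm]
  have h2 : ∀ F : Mat n m → ℚ, ∑ M : Mat n m, (if colSum M.1 = b then F M else 0) =
      ∑ M : {M : Mat n m // colSum M.1 = b}, F M.1 := by
    intro F
    rw [← Finset.sum_filter]
    exact Finset.sum_subtype _ (by simp) _
  simp only [h1]
  rw [h2, (isSym_rowSum n m b).sum_eq (m := m) (fun M i => ?_) (fun M => ?_)
    (fun v => if v = c then 1 else 0), Fintype.sum_sigma]
  · refine Finset.sum_congr rfl fun a _ => ?_
    have h3 : mult (fun M : {M : Mat n m // colSum M.1 = b} => rowSum M.1.1) a.1 =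
        ∑ g : Tab n a.1, if wt n g.1 = b then 1 else 0 := by
      rw [← sum_mat_altDelta a.2 (fun v => if v = b then 1 else 0), mult,
        ← h2 (fun M => altDelta a.1 (shiftVec (rowSum M.1)))]
      simp
    rw [h3, Fintype.sum_prod_type, Finset.sum_mul_sum, Finset.sum_comm]
    refine Finset.sum_congr rfl fun g _ => Finset.sum_congr rfl fun g' _ => ?_
    simp only [Prod.mk.injEq, ite_and, ite_mul, one_mul, zero_mul]
    split_ifs <;> rfl
  · exact Finset.sum_nonneg fun _ _ => Int.natCast_nonneg _
  · simp only [rowSum]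
    rw [Finset.sum_comm]
    exact_mod_cast M.1.2

/-- A content preserving correspondence between matrices and pairs of tableaux. -/
lemma exists_mat_equiv (n m : ℕ) :
    ∃ e : Mat n m ≃ Σ a : Shape n m, Tab n a.1 × Tab n a.1,
      ∀ M, (rowSum M.1, colSum M.1) = (wt n (e M).2.1.1, wt n (e M).2.2.1) :=
  exists_equiv_of_sum_eq (fun M : Mat n m => (rowSum M.1, colSum M.1))
    (fun x : Σ a : Shape n m, Tab n a.1 × Tab n a.1 => (wt n x.2.1.1, wt n x.2.2.1))
    fun v => by convert sum_mat_pair v.1 v.2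

end

noncomputable section

lemma shiftVec_add {n : ℕ} (e w : Fin n → ℤ) : shiftVec (e + w) = shiftVec e + w := by
  funext i
  simp only [shiftVec, Pi.add_apply]
  ring

lemma IsSym.exists_equiv {S : Type*} [Fintype S] {n : ℕ} {f : S → Fin n → ℤ} (hf : IsSym f)
    (π : Perm (Fin n)) : ∃ e : S ≃ S, ∀ s, f s ∘ π = f (e s) := by
  apply exists_equiv_of_sum_eq
  intro v
  convert hf π fun c => if c = v then 1 else 0

lemma IsSym.pi_sum {r n : ℕ} {S : Fin r → Type*} [∀ k, Fintype (S k)]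
    {f : ∀ k, S k → Fin n → ℤ} (hf : ∀ k, IsSym (f k)) :
    IsSym (fun s : (∀ k, S k) => ∑ k, f k (s k)) := by
  intro π F
  choose e he using fun k => (hf k).exists_equiv π
  refine Fintype.sum_equiv (Equiv.piCongrRight e) _ _ fun s => ?_
  congr 1
  funext i
  simp only [Function.comp, Finset.sum_apply]
  exact Finset.sum_congr rfl fun k _ => congrFun (he k (s k)) i

lemma IsAlt.sum_add {S : Type*} [Fintype S] {n : ℕ} {A : (Fin n → ℤ) → ℚ} (hA : IsAlt A)
    {f : S → Fin n → ℤ} (hf : IsSym f) : IsAlt fun e => ∑ s, A (e + f s) := by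
  intro σ e
  simp only
  rw [← hf σ fun w => A (e ∘ σ + w), Finset.mul_sum]
  refine Finset.sum_congr rfl fun s _ => ?_
  rw [← hA]
  rfl

/-- The shape obtained by successively adding contents of the chains `g k'`, `k' < k`, to `b`. -/
def chainSum (n : ℕ) {r : ℕ} (b : ℕ → ℕ) (g : Fin r → ℕ → ℕ → ℕ) (k : Fin (r + 1)) (i : ℕ) : ℕ :=
  b i + ∑ k' : Fin r, if k'.castSucc < k then (wtF n (g k') i).toNat else 0

/-- Every tableau of the tuple is dominant relative to the shape accumulated so far. -/
def DomTuple (n : ℕ) {r : ℕ} (b : ℕ → ℕ) (g : Fin r → ℕ → ℕ → ℕ) : Prop :=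
  ∀ k : Fin r, IsDominant (chainSum n b g k.castSucc) (g k)

lemma chainSum_zero (n : ℕ) {r : ℕ} (b : ℕ → ℕ) (g : Fin r → ℕ → ℕ → ℕ) :
    chainSum n b g 0 = b := by
  funext i
  simp [chainSum]

lemma chainSum_cons (n : ℕ) {r : ℕ} (b : ℕ → ℕ) (g : Fin (r + 1) → ℕ → ℕ → ℕ)
    (k : Fin (r + 1)) : chainSum n b g k.succ =
      chainSum n (fun i => b i + (wtF n (g 0) i).toNat) (fun k => g k.succ) k := by
  funext i
  simp only [chainSum]
  rw [Fin.sum_univ_succ, ← add_assoc]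
  congr 1
  refine Finset.sum_congr rfl fun k' _ => ?_
  simp only [← Fin.succ_castSucc, Fin.succ_lt_succ_iff]

lemma domTuple_cons (n : ℕ) {r : ℕ} (b : ℕ → ℕ) (g : Fin (r + 1) → ℕ → ℕ → ℕ) :
    DomTuple n b g ↔ IsDominant b (g 0) ∧
      DomTuple n (fun i => b i + (wtF n (g 0) i).toNat) (fun k => g k.succ) := by
  simp only [DomTuple]
  rw [Fin.forall_fin_succ, Fin.castSucc_zero, chainSum_zero]
  simp only [← Fin.succ_castSucc, chainSum_cons]

lemma chainSum_last {n r : ℕ} (b : ℕ → ℕ) {lam : Fin r → ℕ → ℕ} (g : ∀ k, Tab n (lam k)) :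
    vec n (chainSum n b (fun k => (g k).1) (Fin.last r)) = vec n b + ∑ k, wt n (g k).1 := by
  funext i
  simp only [vec, chainSum, Fin.castSucc_lt_last, if_true, Pi.add_apply, Finset.sum_apply]
  push_cast
  congr 1
  exact Finset.sum_congr rfl fun k _ => Int.toNat_of_nonneg (wt_nonneg (g k).2 i)

lemma isShape_add {n m m' : ℕ} {a b : ℕ → ℕ} {g : ℕ → ℕ → ℕ} (ha : IsShape n m' a)
    (hb : IsShape n m b) (hg : IsTab n (fun _ => 0) a g) (hd : IsDominant b g) :
    IsShape n (m + m') (fun i => b i + (wtF n g i).toNat) := by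
  refine ⟨?_, fun i hi => ?_, ?_⟩
  · refine fun i j hij => antitone_nat_of_succ_le
      (f := fun i => b i + (wtF n g i).toNat) (fun k => ?_) hij
    have h1 := hd (k, n)
    have h2 := hg.le_last (k + 1) n
    have h3 := hg.le_last (k + 1 + 1) n
    rw [hg.supp n le_rfl] at h2 h3
    simp only [gap, wtF_succ] at h1
    have h4 := wtF_nonneg hg.mono n k
    have h5 := wtF_nonneg hg.mono n (k + 1)
    omega
  · have : wtF n g i = 0 := by
      apply Finset.sum_eq_zero
      intro j _
      rw [hg.last i j hi, hg.last (i + 1) j (by omega), sub_self]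
    rw [this, hb.supp i hi]
    rfl
  · rw [Finset.sum_add_distrib, hb.total]
    congr 1
    have h := sum_wt hg
    have : ∑ i ∈ range n, (a i : ℤ) = m' := by exact_mod_cast ha.total
    rw [this] at h
    rw [Finset.sum_range]
    zify
    rw [← h]
    exact Finset.sum_congr rfl fun i _ => Int.toNat_of_nonneg (wt_nonneg hg i)

/-- Cancellation of the tuples of tableaux which are not successively dominant. -/
lemma sum_tuple {n : ℕ} {A : (Fin n → ℤ) → ℚ} (hA : IsAlt A) :
    ∀ {r : ℕ} {m : Fin r → ℕ} (lam : ∀ k, Shape n (m k)) {m₀ : ℕ} {b : ℕ → ℕ}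
      (_ : IsShape n m₀ b),
    ∑ g : (∀ k, Tab n (lam k).1), A (shiftVec (vec n b + ∑ k, wt n (g k).1)) =
      ∑ g : (∀ k, Tab n (lam k).1), if DomTuple n b (fun k => (g k).1) then
        A (shiftVec (vec n b + ∑ k, wt n (g k).1)) else 0 := by
  intro r
  induction r with
  | zero =>
    intro m lam m₀ b hb
    refine Finset.sum_congr rfl fun g _ => ?_
    rw [if_pos]
    exact fun k => k.elim0
  | succ r ih =>
    intro m lam m₀ b hb
    have split : ∀ F : (∀ k, Tab n (lam k).1) → ℚ, ∑ g, F g =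
        ∑ g₀ : Tab n (lam 0).1, ∑ g : (∀ k : Fin r, Tab n (lam k.succ).1),
          F (Fin.cons (α := fun k => Tab n (lam k).1) g₀ g) := by
      intro F
      rw [← Fintype.sum_prod_type']
      exact (Fintype.sum_equiv (Fin.consEquiv fun k => Tab n (lam k).1) _ _ fun x => rfl).symm
    have hA' := hA.sum_add (IsSym.pi_sum fun k : Fin r => isSym_wt (lam k.succ).2)
    have h1 := sum_tab hA' (lam 0).1 hb
    rw [split, split]
    simp only [Fin.sum_univ_succ, Fin.cons_zero, Fin.cons_succ, domTuple_cons]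
    simp only [← add_assoc, shiftVec_add (vec n b + wt n _)]
    rw [h1]
    refine Finset.sum_congr rfl fun g₀ _ => ?_
    by_cases hd : IsDominant b g₀.1
    · simp only [hd, true_and, if_true]
      have h2 := ih (fun k => lam k.succ) (isShape_add (lam 0).2 hb g₀.2 hd)
      have h3 : vec n (fun i => b i + (wtF n g₀.1 i).toNat) = vec n b + wt n g₀.1 := by
        funext i
        simp only [vec, Pi.add_apply]
        push_cast
        congr 1
        exact Int.toNat_of_nonneg (wt_nonneg g₀.2 i)
      simp only [h3, shiftVec_add (vec n b + wt n _)] at h2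
      exact h2
    · simp [hd]

lemma isShape_chainSum {n : ℕ} : ∀ {r : ℕ} {m : Fin r → ℕ} (lam : ∀ k, Shape n (m k)) {m₀ : ℕ}
    {b : ℕ → ℕ} (_ : IsShape n m₀ b) (g : ∀ k, Tab n (lam k).1)
    (_ : DomTuple n b (fun k => (g k).1)) (k : Fin (r + 1)),
    ∃ m', IsShape n m' (chainSum n b (fun k => (g k).1) k) := by
  intro r
  induction r with
  | zero =>
    intro m lam m₀ b hb g hd k
    obtain rfl : k = 0 := Fin.fin_one_eq_zero k
    exact ⟨m₀, by rwa [chainSum_zero]⟩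
  | succ r ih =>
    intro m lam m₀ b hb g hd k
    rw [domTuple_cons] at hd
    cases k using Fin.cases with
    | zero => exact ⟨m₀, by rwa [chainSum_zero]⟩
    | succ k =>
      rw [chainSum_cons]
      exact ih (fun k => lam k.succ) (isShape_add (lam 0).2 hb (g 0).2 hd.1)
        (fun k => g k.succ) hd.2 k

/-- The alternating sum over tuples of tableaux counts the successively dominant tuples. -/
lemma sum_tuple_altDelta {n r m' : ℕ} {m : Fin r → ℕ} (lam : ∀ k, Shape n (m k)) {a : ℕ → ℕ}
    (ha : IsShape n m' a) :
    ∑ g : (∀ k, Tab n (lam k).1), altDelta a (shiftVec (∑ k, wt n (g k).1)) =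
      Nat.card {g : (∀ k, Tab n (lam k).1) // DomTuple n (fun _ => 0) (fun k => (g k).1) ∧
        chainSum n (fun _ => 0) (fun k => (g k).1) (Fin.last r) = a} := by
  have h := sum_tuple (isAlt_altDelta a) lam (isShape_zero n)
  have h0 : vec n (fun _ => 0) = 0 := by
    funext i
    simp [vec]
  simp only [← chainSum_last] at h
  have h1 : ∀ g : (∀ k, Tab n (lam k).1), (if DomTuple n (fun _ => 0) (fun k => (g k).1) then
      altDelta a (shiftVec (vec n (chainSum n (fun _ => 0) (fun k => (g k).1) (Fin.last r))))
      else 0) = if DomTuple n (fun _ => 0) (fun k => (g k).1) ∧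
        chainSum n (fun _ => 0) (fun k => (g k).1) (Fin.last r) = a then 1 else 0 := by
    intro g
    by_cases hd : DomTuple n (fun _ => 0) (fun k => (g k).1)
    · obtain ⟨m'', hs⟩ := isShape_chainSum lam (isShape_zero n) g hd (Fin.last r)
      simp only [hd, true_and, if_true, altDelta_shape ha hs, eq_comm]
    · simp [hd]
  simp only [h1] at h
  simp only [chainSum_last, h0, zero_add] at h
  rw [h, Finset.sum_boole, Nat.card_eq_fintype_card, Fintype.card_subtype]

end

noncomputable section

/-- Semistandard fillings of the skew shape `a/b` with entries less than `n`. -/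
structure IsSkew (n : ℕ) (a b : ℕ → ℕ) (T : ℕ → ℕ → ℕ) : Prop where
  zero : ∀ i j, ¬(b i ≤ j ∧ j < a i) → T i j = 0
  row : ∀ i j₁ j₂, b i ≤ j₁ → j₁ ≤ j₂ → j₂ < a i → T i j₁ ≤ T i j₂
  col : ∀ i₁ i₂ j, i₁ < i₂ → b i₁ ≤ j → j < a i₁ → b i₂ ≤ j → j < a i₂ → T i₁ j < T i₂ j
  bound : ∀ i j, b i ≤ j → j < a i → T i j < n

/-- The chain of shapes of a skew tableau. -/
def toChain (a b : ℕ → ℕ) (T : ℕ → ℕ → ℕ) (k i : ℕ) : ℕ :=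
  b i + ((Finset.Ico (b i) (a i)).filter fun j => T i j < k).card

/-- The skew tableau of a chain of shapes. -/
def fromChain (n : ℕ) (a b : ℕ → ℕ) (h : ℕ → ℕ → ℕ) (i j : ℕ) : ℕ :=
  if b i ≤ j ∧ j < a i then ((range n).filter fun k => h (k + 1) i ≤ j).card else 0

/-- The chain `h` records the positions of the entries of `T`. -/
def ChainRel (a b : ℕ → ℕ) (T h : ℕ → ℕ → ℕ) : Prop :=
  ∀ i j k, b i ≤ j → j < a i → (T i j < k ↔ j < h k i)

lemma mem_iff_of_initial {a b : ℕ} {P : ℕ → Prop} (hP : ∀ j j', a ≤ j → j ≤ j' → j' < b → P j' → P j)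
    {j : ℕ} (h1 : a ≤ j) (h2 : j < b) : P j ↔ j < a + ((Finset.Ico a b).filter P).card := by
  constructor
  · intro h
    have : Finset.Icc a j ⊆ (Finset.Ico a b).filter P := by
      intro x hx
      rw [Finset.mem_Icc] at hx
      rw [Finset.mem_filter, Finset.mem_Ico]
      exact ⟨⟨hx.1, by omega⟩, hP x j hx.1 hx.2 h2 h⟩
    have := Finset.card_le_card this
    rw [Nat.card_Icc] at this
    omega
  · intro h
    by_contra hc
    have : (Finset.Ico a b).filter P ⊆ Finset.Ico a j := by
      intro x hx
      rw [Finset.mem_filter, Finset.mem_Ico] at hx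
      rw [Finset.mem_Ico]
      refine ⟨hx.1.1, ?_⟩
      by_contra hlt
      exact hc (hP j x h1 (by omega) hx.1.2 hx.2)
    have := Finset.card_le_card this
    rw [Nat.card_Ico] at this
    omega

lemma toChain_le {a b : ℕ → ℕ} (hab : ∀ i, b i ≤ a i) (T : ℕ → ℕ → ℕ) (k i : ℕ) :
    toChain a b T k i ≤ a i := by
  have := Finset.card_filter_le (Finset.Ico (b i) (a i)) fun j => T i j < k
  rw [Nat.card_Ico] at this
  have := hab i
  simp only [toChain]
  omega

lemma chainRel_toChain {n : ℕ} {a b : ℕ → ℕ} {T : ℕ → ℕ → ℕ} (hT : IsSkew n a b T) :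
    ChainRel a b T (toChain a b T) := by
  intro i j k h1 h2
  rw [toChain]
  convert mem_iff_of_initial (P := fun j => T i j < k)
    (fun j j' h3 h4 h5 h6 => lt_of_le_of_lt (hT.row i j j' h3 h4 h5) h6) h1 h2

lemma isTab_toChain {n : ℕ} {a b : ℕ → ℕ} (hab : ∀ i, b i ≤ a i) (ha : ∀ i j, i ≤ j → a j ≤ a i)
    (hb : ∀ i j, i ≤ j → b j ≤ b i) {T : ℕ → ℕ → ℕ} (hT : IsSkew n a b T) :
    IsTab n b a (toChain a b T) := by
  have hR := chainRel_toChain hT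
  refine ⟨fun i => by simp [toChain], fun k i => ?_, fun k i hk => ?_, fun k i => ?_⟩
  · apply Nat.add_le_add_left
    apply Finset.card_le_card
    intro j
    simp only [Finset.mem_filter]
    exact fun h => ⟨h.1, by omega⟩
  · simp only [toChain]
    rw [Finset.filter_true_of_mem, Nat.card_Ico]
    · have := hab i
      omega
    · intro j hj
      rw [Finset.mem_Ico] at hj
      exact lt_of_lt_of_le (hT.bound i j hj.1 hj.2) hk
  · by_contra hc
    push Not at hc
    have h1 : b i ≤ toChain a b T k i := Nat.le_add_right _ _
    have h2 := toChain_le hab T (k + 1) (i + 1)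
    have h3 := ha i (i + 1) (by omega)
    have h4 := hb i (i + 1) (by omega)
    have h5 := (hR (i + 1) (toChain a b T k i) (k + 1) (by omega) (by omega)).2 hc
    have h6 := hT.col i (i + 1) (toChain a b T k i) (by omega) h1 (by omega) (by omega) (by omega)
    have h7 := (hR i (toChain a b T k i) k h1 (by omega)).1 (by omega)
    omega

lemma IsTab.anti_step {n : ℕ} {a b : ℕ → ℕ} {h : ℕ → ℕ → ℕ} (hh : IsTab n b a h) (k : ℕ) {i i' : ℕ}
    (hi : i < i') : h (k + 1) i' ≤ h k i := by
  have : Antitone fun i => h (k + 1) i :=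
    antitone_nat_of_succ_le fun i => (hh.strict k i).trans (hh.mono k i)
  exact (this (Nat.succ_le_of_lt hi)).trans (hh.strict k i)

lemma chainRel_fromChain {n : ℕ} {a b : ℕ → ℕ} {h : ℕ → ℕ → ℕ} (hh : IsTab n b a h) :
    ChainRel a b (fromChain n a b h) h ∧
      ∀ i j, b i ≤ j → j < a i → fromChain n a b h i j < n := by
  have key : ∀ i j k, b i ≤ j → j < a i → k < n → (h (k + 1) i ≤ j ↔ k < fromChain n a b h i j) := by
    intro i j k h1 h2 hk
    have := mem_iff_of_initial (a := 0) (b := n) (P := fun k => h (k + 1) i ≤ j)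
      (fun k k' _ h4 _ h6 => (mono_of_step hh.mono (by omega) i).trans h6) (Nat.zero_le k) hk
    rw [this, fromChain, if_pos ⟨h1, h2⟩, zero_add, Finset.range_eq_Ico]
    convert Iff.rfl
  have bound : ∀ i j, b i ≤ j → j < a i → fromChain n a b h i j < n := by
    intro i j h1 h2
    rcases Nat.eq_zero_or_pos n with hn | hn
    · have h3 := hh.last 0 i (by omega)
      rw [hh.zero] at h3
      omega
    · have h3 := key i j (n - 1) h1 h2 (by omega)
      rw [show n - 1 + 1 = n by omega, hh.last n i le_rfl] at h3
      omega
  refine ⟨fun i j k h1 h2 => ?_, bound⟩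
  have h3 := bound i j h1 h2
  rcases k with _ | k
  · rw [hh.zero]
    omega
  · by_cases hk : k < n
    · have := key i j k h1 h2 hk
      omega
    · rw [hh.last (k + 1) i (by omega)]
      omega

lemma isSkew_fromChain {n : ℕ} {a b : ℕ → ℕ} {h : ℕ → ℕ → ℕ} (hh : IsTab n b a h) :
    IsSkew n a b (fromChain n a b h) := by
  obtain ⟨hR, hbound⟩ := chainRel_fromChain hh
  refine ⟨fun i j hij => if_neg hij, fun i j₁ j₂ h1 h2 h3 => ?_, fun i₁ i₂ j h1 h2 h3 h4 h5 => ?_,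
    hbound⟩
  · have h4 := (hR i j₂ (fromChain n a b h i j₂ + 1) (by omega) h3).1 (by omega)
    have h5 := (hR i j₁ (fromChain n a b h i j₂ + 1) h1 (by omega)).2 (by omega)
    omega
  · have h6 := (hR i₂ j (fromChain n a b h i₂ j + 1) h4 h5).1 (by omega)
    exact (hR i₁ j _ h2 h3).2 (lt_of_lt_of_le h6 (hh.anti_step _ h1))

lemma ChainRel.eq_left {n n' : ℕ} {a b : ℕ → ℕ} {T T' h : ℕ → ℕ → ℕ} (hT : IsSkew n a b T)
    (hT' : IsSkew n' a b T') (h1 : ChainRel a b T h) (h2 : ChainRel a b T' h) : T = T' := by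
  funext i j
  by_cases hij : b i ≤ j ∧ j < a i
  · have h3 := fun k => (h1 i j k hij.1 hij.2).trans (h2 i j k hij.1 hij.2).symm
    have h4 := h3 (T i j)
    have h5 := h3 (T' i j)
    omega
  · rw [hT.zero i j hij, hT'.zero i j hij]

lemma ChainRel.eq_right {n : ℕ} {a b : ℕ → ℕ} {T h h' : ℕ → ℕ → ℕ} (hh : IsTab n b a h)
    (hh' : IsTab n b a h') (h1 : ChainRel a b T h) (h2 : ChainRel a b T h') : h = h' := by
  funext k i
  have h3 := hh.le_last k i
  have h4 := hh.first_le k i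
  have h5 := hh'.le_last k i
  have h6 := hh'.first_le k i
  rcases lt_trichotomy (h k i) (h' k i) with hlt | heq | hlt
  · have := (h1 i (h k i) k h4 (by omega)).1 ((h2 i (h k i) k h4 (by omega)).2 hlt)
    omega
  · exact heq
  · have := (h2 i (h' k i) k h6 (by omega)).1 ((h1 i (h' k i) k h6 (by omega)).2 hlt)
    omega

/-- Skew tableaux correspond to chains of shapes. -/
def skewEquiv (n : ℕ) {a b : ℕ → ℕ} (hab : ∀ i, b i ≤ a i) (ha : ∀ i j, i ≤ j → a j ≤ a i)
    (hb : ∀ i j, i ≤ j → b j ≤ b i) :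
    {T : ℕ → ℕ → ℕ // IsSkew n a b T} ≃ {h : ℕ → ℕ → ℕ // IsTab n b a h} where
  toFun T := ⟨toChain a b T.1, isTab_toChain hab ha hb T.2⟩
  invFun h := ⟨fromChain n a b h.1, isSkew_fromChain h.2⟩
  left_inv T := Subtype.ext (ChainRel.eq_left (isSkew_fromChain (isTab_toChain hab ha hb T.2)) T.2
    (chainRel_fromChain (isTab_toChain hab ha hb T.2)).1 (chainRel_toChain T.2))
  right_inv h := Subtype.ext (ChainRel.eq_right (isTab_toChain hab ha hb (isSkew_fromChain h.2)) h.2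
    (chainRel_toChain (isSkew_fromChain h.2)) (chainRel_fromChain h.2).1)

lemma card_rows (n : ℕ) (f : ℕ → Finset ℕ) {P : ℕ × ℕ → Prop}
    (h : ∀ i j, P (i, j) ↔ i < n ∧ j ∈ f i) :
    Nat.card {p // P p} = ∑ i ∈ range n, (f i).card := by
  rw [← Finset.card_sigma, ← Finset.card_map (Equiv.sigmaEquivProd ℕ ℕ).toEmbedding]
  refine Nat.subtype_card _ fun p => ?_
  obtain ⟨i, j⟩ := p
  rw [h]
  simp [Equiv.sigmaEquivProd]

lemma ChainRel.eq_iff {n : ℕ} {a b : ℕ → ℕ} {T h : ℕ → ℕ → ℕ} (hh : IsTab n b a h)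
    (hR : ChainRel a b T h) (i j k : ℕ) :
    (b i ≤ j ∧ j < a i ∧ T i j = k) ↔ h k i ≤ j ∧ j < h (k + 1) i := by
  have h3 := hh.le_last (k + 1) i
  have h4 := hh.first_le k i
  constructor
  · rintro ⟨h1, h2, h5⟩
    have h6 := hR i j k h1 h2
    have h7 := hR i j (k + 1) h1 h2
    omega
  · rintro ⟨h1, h2⟩
    have h6 := hR i j k (by omega) (by omega)
    have h7 := hR i j (k + 1) (by omega) (by omega)
    omega

lemma skewContent_eq {n : ℕ} {a b : ℕ → ℕ} {T h : ℕ → ℕ → ℕ} (ha : ∀ i, n ≤ i → a i = 0)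
    (hh : IsTab n b a h) (hR : ChainRel a b T h) (k : ℕ) :
    (skewContent a b T k : ℤ) = wtF n h k := by
  rw [skewContent, card_rows n (fun i => Finset.Ico (h k i) (h (k + 1) i)), wtF_eq hh.mono]
  · simp
  · intro i j
    rw [hR.eq_iff hh, Finset.mem_Ico]
    constructor
    · intro h1
      refine ⟨?_, h1⟩
      by_contra hc
      have := hh.le_last (k + 1) i
      rw [ha i (by omega)] at this
      simp only at h1
      omega
    · exact fun h1 => h1.2

lemma lrCount_eq {n : ℕ} {a b : ℕ → ℕ} {T h : ℕ → ℕ → ℕ}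
    (hh : IsTab n b a h) (hR : ChainRel a b T h) (i j k : ℕ) :
    (lrCount a b T i j k : ℤ) =
      wtF i h k + ((h (k + 1) i - max j (h k i) : ℕ) : ℤ) := by
  rw [lrCount, card_rows (i + 1) (fun i' => if i' < i then Finset.Ico (h k i') (h (k + 1) i') else
    Finset.Ico (max j (h k i')) (h (k + 1) i')), Finset.sum_range_succ, if_neg (lt_irrefl i),
    wtF_eq hh.mono, Nat.card_Ico]
  · push_cast
    congr 1
    refine Finset.sum_congr rfl fun i' hi' => ?_
    rw [if_pos (Finset.mem_range.1 hi'), Nat.card_Ico]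
  · intro i' j'
    simp only
    rw [hR.eq_iff hh]
    split_ifs with h1
    · rw [Finset.mem_Ico]
      omega
    · rw [Finset.mem_Ico, max_le_iff]
      constructor
      · rintro ⟨h2, h3⟩
        have : i' = i := by omega
        exact ⟨by omega, by omega⟩
      · rintro ⟨h2, h3⟩
        have : i' = i := by omega
        exact ⟨Or.inr ⟨this, h3.1.1⟩, h3.1.2, h3.2⟩

lemma lattice_iff {n : ℕ} {a b : ℕ → ℕ} {T h : ℕ → ℕ → ℕ}
    (hh : IsTab n b a h) (hR : ChainRel a b T h) :
    (∀ i j k, lrCount a b T i j (k + 1) ≤ lrCount a b T i j k) ↔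
      ∀ i k, wtF (i + 1) h (k + 1) ≤ wtF i h k := by
  have key : ∀ i j k, lrCount a b T i j (k + 1) ≤ lrCount a b T i j k ↔
      wtF i h (k + 1) + ((h (k + 1 + 1) i - max j (h (k + 1) i) : ℕ) : ℤ) ≤
        wtF i h k + ((h (k + 1) i - max j (h k i) : ℕ) : ℤ) := by
    intro i j k
    rw [← lrCount_eq hh hR, ← lrCount_eq hh hR, Nat.cast_le]
  simp only [key, wtF_succ]
  constructor
  · intro H i k
    have h1 := H i (h (k + 1) i) k
    have h2 := hh.mono k i
    have h3 := hh.mono (k + 1) i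
    omega
  · intro H i j k
    have h1 := H i k
    have h2 := hh.mono k i
    have h3 := hh.mono (k + 1) i
    omega

end

noncomputable section

/-- Transposition of chains: entries of row `i` below row `k`. -/
def transChain (b : ℕ → ℕ) (g : ℕ → ℕ → ℕ) (k i : ℕ) : ℕ := b i + (wtF k g i).toNat

lemma transChain_eq {b : ℕ → ℕ} {g : ℕ → ℕ → ℕ} (h : ∀ k i, g k i ≤ g (k + 1) i) (k i : ℕ) :
    (transChain b g k i : ℤ) = b i + wtF k g i := by
  have := wtF_nonneg h k i
  simp only [transChain]
  omega

lemma wtF_transChain {b : ℕ → ℕ} {g : ℕ → ℕ → ℕ} (h : ∀ k i, g k i ≤ g (k + 1) i) (k i : ℕ) :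
    wtF i (transChain b g) k + g 0 k = ∑ i' ∈ range i, ((b i' : ℤ) - b i') + g i k := by
  induction i with
  | zero => simp [wtF]
  | succ i ih =>
    rw [wtF_succ, transChain_eq h, transChain_eq h, wtF_succ, Finset.sum_range_succ]
    linarith

lemma wtF_transChain' {b : ℕ → ℕ} {g : ℕ → ℕ → ℕ} (h : ∀ k i, g k i ≤ g (k + 1) i) (k i : ℕ) :
    wtF i (transChain b g) k = (g i k : ℤ) - g 0 k := by
  have := wtF_transChain (b := b) h k i
  simp only [sub_self, Finset.sum_const_zero, zero_add] at this
  linarith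

lemma transChain_mono {b : ℕ → ℕ} {g : ℕ → ℕ → ℕ} (h : ∀ k i, g k i ≤ g (k + 1) i) (k i : ℕ) :
    transChain b g k i ≤ transChain b g (k + 1) i := by
  rw [← Int.ofNat_le, transChain_eq h, transChain_eq h, wtF_succ]
  have := h i k
  omega

lemma transChain_transChain {b c : ℕ → ℕ} {g : ℕ → ℕ → ℕ} (h : ∀ k i, g k i ≤ g (k + 1) i)
    (hc : ∀ i, g 0 i = c i) : transChain c (transChain b g) = g := by
  funext k i
  rw [← Int.ofNat_inj, transChain_eq (transChain_mono h), wtF_transChain' h, hc]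
  ring

lemma wtF_eq_of_le {n : ℕ} {g : ℕ → ℕ → ℕ} (h : ∀ k i, n ≤ i → g k i = 0) {k : ℕ} (hk : n ≤ k)
    (i : ℕ) : wtF k g i = wtF n g i := by
  symm
  apply Finset.sum_subset (by simpa using hk)
  intro x _ hx
  rw [Finset.mem_range, not_lt] at hx
  rw [h _ _ hx, h _ _ hx, sub_self]

/-- Transposition of Littlewood–Richardson fillings. -/
def transEquiv {n : ℕ} {a b l : ℕ → ℕ} (ha : ∀ i, n ≤ i → a i = 0) :
    {h : ℕ → ℕ → ℕ // IsTab n b a h ∧ (∀ i k, wtF (i + 1) h (k + 1) ≤ wtF i h k) ∧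
      ∀ k, wtF n h k = l k} ≃
    {g : ℕ → ℕ → ℕ // IsTab n (fun _ => 0) l g ∧ IsDominant b g ∧
      ∀ i, b i + wtF n g i = a i} where
  toFun h := ⟨transChain (fun _ => 0) h.1, by
    obtain ⟨h, hh, hl, hc⟩ := h
    have h0 : ∀ k i, n ≤ i → h k i = 0 := fun k i hi => by
      have := hh.le_last k i
      rw [ha i hi] at this
      omega
    refine ⟨⟨fun i => by simp [transChain, wtF], transChain_mono hh.mono, fun k i hk => ?_,
      fun k i => ?_⟩, ?_, ?_⟩
    · rw [← Int.ofNat_inj, transChain_eq hh.mono, wtF_eq_of_le h0 hk, hc]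
      simp
    · rw [← Int.ofNat_le, transChain_eq hh.mono, transChain_eq hh.mono]
      simpa using hl k i
    · rintro ⟨k, i⟩
      simp only [gap]
      rw [wtF_transChain' hh.mono, wtF_transChain' hh.mono, hh.zero, hh.zero]
      have := hh.strict i k
      omega
    · intro i
      rw [wtF_transChain' hh.mono, hh.zero, hh.last n i le_rfl]
      ring⟩
  invFun g := ⟨transChain b g.1, by
    obtain ⟨g, hg, hd, hc⟩ := g
    have h0 : ∀ k i, n ≤ i → g k i = 0 := fun k i hi => by
      have := hg.le_last k i
      rw [hg.supp i hi] at this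
      omega
    refine ⟨⟨fun i => by simp [transChain, wtF], transChain_mono hg.mono, fun k i hk => ?_,
      fun k i => ?_⟩, ?_, ?_⟩
    · rw [← Int.ofNat_inj, transChain_eq hg.mono, wtF_eq_of_le h0 hk, hc]
    · rw [← Int.ofNat_le, transChain_eq hg.mono, transChain_eq hg.mono]
      have := hd (i, k)
      simp only [gap] at this
      omega
    · intro i k
      rw [wtF_transChain' hg.mono, wtF_transChain' hg.mono, hg.zero, hg.zero]
      have := hg.strict i k
      omega
    · intro k
      rw [wtF_transChain' hg.mono, hg.zero, hg.last n k le_rfl]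
      simp⟩
  left_inv h := Subtype.ext (transChain_transChain h.2.1.mono h.2.1.zero)
  right_inv g := Subtype.ext (transChain_transChain g.2.1.mono g.2.1.zero)

lemma skewContent_eq_sum {n : ℕ} {a : ℕ → ℕ} (ha : ∀ i, n ≤ i → a i = 0) (b : ℕ → ℕ)
    (T : ℕ → ℕ → ℕ) (k : ℕ) :
    skewContent a b T k =
      ∑ i ∈ range n, ((Finset.Ico (b i) (a i)).filter fun j => T i j = k).card := by
  refine card_rows n _ fun i j => ?_
  simp only [Finset.mem_filter, Finset.mem_Ico]
  constructor
  · intro h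
    refine ⟨?_, ⟨h.1, h.2.1⟩, h.2.2⟩
    by_contra hc
    rw [ha i (by omega)] at h
    omega
  · exact fun h => ⟨h.2.1.1, h.2.1.2, h.2.2⟩

lemma skewSize_eq_sum {n : ℕ} {a : ℕ → ℕ} (ha : ∀ i, n ≤ i → a i = 0) (b : ℕ → ℕ) :
    skewSize a b = ∑ i ∈ range n, (a i - b i) := by
  rw [skewSize, card_rows n (fun i => Finset.Ico (b i) (a i))]
  · simp
  intro i j
  simp only [Finset.mem_Ico]
  constructor
  · intro h
    refine ⟨?_, h⟩
    by_contra hc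
    rw [ha i (by omega)] at h
    omega
  · exact fun h => h.2

lemma sum_skewContent {n : ℕ} {a : ℕ → ℕ} (ha : ∀ i, n ≤ i → a i = 0) (b : ℕ → ℕ)
    (T : ℕ → ℕ → ℕ) (N : ℕ) :
    ∑ k ∈ range N, skewContent a b T k =
      ∑ i ∈ range n, ((Finset.Ico (b i) (a i)).filter fun j => T i j < N).card := by
  simp only [skewContent_eq_sum ha]
  rw [Finset.sum_comm]
  refine Finset.sum_congr rfl fun i _ => ?_
  rw [← Finset.card_biUnion]
  · congr 1
    ext j
    simp only [Finset.mem_biUnion, Finset.mem_filter, Finset.mem_range]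
    constructor
    · rintro ⟨k, hk, h1, rfl⟩
      exact ⟨h1, hk⟩
    · rintro ⟨h1, h2⟩
      exact ⟨_, h2, h1, rfl⟩
  · intro k _ k' _ hkk'
    rw [Function.onFun, Finset.disjoint_left]
    intro j h1 h2
    rw [Finset.mem_filter] at h1 h2
    exact hkk' (h1.2.symm.trans h2.2)

lemma sum_skewContent_le {n : ℕ} {a : ℕ → ℕ} (ha : ∀ i, n ≤ i → a i = 0) (b : ℕ → ℕ)
    (T : ℕ → ℕ → ℕ) (N : ℕ) : ∑ k ∈ range N, skewContent a b T k ≤ skewSize a b := by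
  rw [sum_skewContent ha, skewSize_eq_sum ha]
  refine Finset.sum_le_sum fun i _ => ?_
  rw [← Nat.card_Ico]
  exact Finset.card_filter_le _ _

lemma skewContent_pos {n : ℕ} {a b : ℕ → ℕ} (ha : ∀ i, n ≤ i → a i = 0)
    (T : ℕ → ℕ → ℕ) {i j : ℕ} (h1 : b i ≤ j) (h2 : j < a i) : 0 < skewContent a b T (T i j) := by
  have hi : i < n := by
    by_contra hc
    rw [ha i (by omega)] at h2
    omega
  rw [skewContent_eq_sum ha]
  refine lt_of_lt_of_le (Finset.card_pos.2 ⟨j, ?_⟩) (Finset.single_le_sum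
    (f := fun i' => ((Finset.Ico (b i') (a i')).filter fun j' => T i' j' = T i j).card)
    (fun _ _ => Nat.zero_le _) (Finset.mem_range.2 hi))
  simp [h1, h2]

lemma sum_skewContent_eq {n : ℕ} {a : ℕ → ℕ} (ha : ∀ i, n ≤ i → a i = 0) (b : ℕ → ℕ)
    (T : ℕ → ℕ → ℕ) {N : ℕ} (hN : ∀ k, N ≤ k → skewContent a b T k = 0) :
    ∑ k ∈ range N, skewContent a b T k = skewSize a b := by
  rw [sum_skewContent ha, skewSize_eq_sum ha]
  refine Finset.sum_congr rfl fun i _ => ?_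
  rw [← Nat.card_Ico, Finset.filter_true_of_mem]
  intro j hj
  rw [Finset.mem_Ico] at hj
  by_contra hc
  have h1 := skewContent_pos ha T hj.1 hj.2
  rw [hN _ (by omega)] at h1
  omega

lemma skewContent_anti {n : ℕ} {a b : ℕ → ℕ} {T : ℕ → ℕ → ℕ} (ha : ∀ i, n ≤ i → a i = 0)
    (hT : IsLR a b T) : ∀ k l, k ≤ l → skewContent a b T l ≤ skewContent a b T k := by
  intro k l hkl
  refine antitone_nat_of_succ_le (f := skewContent a b T) (fun k => ?_) hkl
  have key : ∀ k, lrCount a b T n 0 k = skewContent a b T k := by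
    intro k
    rw [lrCount, skewContent]
    refine Nat.card_congr (Equiv.subtypeEquivRight fun p => ?_)
    constructor
    · exact fun h => h.2
    · intro h
      refine ⟨Or.inl ?_, h⟩
      by_contra hc
      rw [ha _ (by omega)] at h
      omega
  rw [← key, ← key]
  exact hT.2.2.2 n 0 k

lemma isShape_skewContent {n m : ℕ} {a b : ℕ → ℕ} {T : ℕ → ℕ → ℕ} (ha : ∀ i, n ≤ i → a i = 0)
    (hT : IsLR a b T) (hm : skewSize a b = m) (hmn : m ≤ n) :
    IsShape n m (skewContent a b T) := by
  have h1 := skewContent_anti ha hT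
  have h0 : ∀ k, n ≤ k → skewContent a b T k = 0 := by
    intro k hk
    by_contra hc
    have h2 := sum_skewContent_le ha b T (n + 1)
    have h3 : ∑ k ∈ range (n + 1), 1 ≤ ∑ k ∈ range (n + 1), skewContent a b T k := by
      refine Finset.sum_le_sum fun l hl => ?_
      rw [Finset.mem_range] at hl
      have := h1 l k (by omega)
      omega
    simp at h3
    omega
  exact ⟨h1, h0, by rw [sum_skewContent_eq ha b T h0, hm]⟩

/-- Littlewood–Richardson fillings of a given content, as dominant tableaux. -/
def lrEquiv {n : ℕ} {a b l : ℕ → ℕ} (hab : ∀ i, b i ≤ a i) (ha : ∀ i j, i ≤ j → a j ≤ a i)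
    (hb : ∀ i j, i ≤ j → b j ≤ b i) (ha0 : ∀ i, n ≤ i → a i = 0) (hl0 : ∀ i, n ≤ i → l i = 0) :
    {T : ℕ → ℕ → ℕ // IsLR a b T ∧ skewContent a b T = l} ≃
    {g : ℕ → ℕ → ℕ // IsTab n (fun _ => 0) l g ∧ IsDominant b g ∧
      ∀ i, b i + wtF n g i = a i} :=
  calc {T : ℕ → ℕ → ℕ // IsLR a b T ∧ skewContent a b T = l}
      ≃ {T : ℕ → ℕ → ℕ // IsSkew n a b T ∧ (∀ i j k, lrCount a b T i j (k + 1) ≤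
          lrCount a b T i j k) ∧ skewContent a b T = l} := Equiv.subtypeEquivRight fun T => by
        constructor
        · rintro ⟨h, hc⟩
          refine ⟨⟨h.1, h.2.1, h.2.2.1, fun i j h1 h2 => ?_⟩, h.2.2.2, hc⟩
          have h3 := skewContent_pos ha0 T h1 h2
          by_contra hn
          rw [hc, hl0 _ (by omega)] at h3
          omega
        · rintro ⟨h, h1, h2⟩
          exact ⟨⟨h.zero, h.row, h.col, h1⟩, h2⟩
    _ ≃ {T : {T : ℕ → ℕ → ℕ // IsSkew n a b T} // (∀ i j k, lrCount a b T.1 i j (k + 1) ≤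
          lrCount a b T.1 i j k) ∧ skewContent a b T.1 = l} :=
        (Equiv.subtypeSubtypeEquivSubtypeInter _ (fun T => (∀ i j k, lrCount a b T i j (k + 1) ≤
          lrCount a b T i j k) ∧ skewContent a b T = l)).symm
    _ ≃ {h : {h : ℕ → ℕ → ℕ // IsTab n b a h} // (∀ i k, wtF (i + 1) h.1 (k + 1) ≤ wtF i h.1 k) ∧
          ∀ k, wtF n h.1 k = l k} := (skewEquiv n hab ha hb).subtypeEquiv fun T => by
        have h1 := isTab_toChain hab ha hb T.2
        have h2 := chainRel_toChain T.2
        change _ ↔ (∀ i k, wtF (i + 1) (toChain a b T.1) (k + 1) ≤ wtF i (toChain a b T.1) k) ∧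
          ∀ k, wtF n (toChain a b T.1) k = l k
        rw [← lattice_iff h1 h2]
        simp only [← skewContent_eq ha0 h1 h2, Nat.cast_inj, funext_iff]
    _ ≃ {h : ℕ → ℕ → ℕ // IsTab n b a h ∧ (∀ i k, wtF (i + 1) h (k + 1) ≤ wtF i h k) ∧
          ∀ k, wtF n h k = l k} := Equiv.subtypeSubtypeEquivSubtypeInter _ (fun h : ℕ → ℕ → ℕ =>
            (∀ i k, wtF (i + 1) h (k + 1) ≤ wtF i h k) ∧ ∀ k, wtF n h k = l k)
    _ ≃ _ := transEquiv ha0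

lemma kostka_eq {n : ℕ} {a c : ℕ → ℕ} (ha : ∀ i j, i ≤ j → a j ≤ a i) (ha0 : ∀ i, n ≤ i → a i = 0)
    (hc : ∀ i, n ≤ i → c i = 0) :
    kostka a c = Nat.card {g : Tab n a // wt n g.1 = vec n c} := by
  refine Nat.card_congr ?_
  calc {T : ℕ → ℕ → ℕ // IsSSYT a T ∧ ∀ k, skewContent a (fun _ => 0) T k = c k}
      ≃ {T : ℕ → ℕ → ℕ // IsSkew n a (fun _ => 0) T ∧ ∀ k, skewContent a (fun _ => 0) T k = c k} :=
        Equiv.subtypeEquivRight fun T => by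
        constructor
        · rintro ⟨h, h1⟩
          refine ⟨⟨fun i j h2 => h.1 i j (by omega), fun i j₁ j₂ _ h2 h3 => h.2.1 i j₁ j₂ h2 h3,
            fun i₁ i₂ j h2 _ _ _ h3 => h.2.2 i₁ i₂ j h2 h3, fun i j h2 h3 => ?_⟩, h1⟩
          have h4 := skewContent_pos (b := fun _ => 0) ha0 T h2 h3
          by_contra hn
          rw [h1, hc _ (by omega)] at h4
          omega
        · rintro ⟨h, h1⟩
          refine ⟨⟨fun i j h2 => h.zero i j (by omega), fun i j₁ j₂ h2 h3 =>
            h.row i j₁ j₂ (Nat.zero_le _) h2 h3, fun i₁ i₂ j h2 h3 => h.col i₁ i₂ j h2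
            (Nat.zero_le _) (lt_of_lt_of_le h3 (ha _ _ h2.le)) (Nat.zero_le _) h3⟩, h1⟩
    _ ≃ {T : {T : ℕ → ℕ → ℕ // IsSkew n a (fun _ => 0) T} //
          ∀ k, skewContent a (fun _ => 0) T.1 k = c k} :=
        (Equiv.subtypeSubtypeEquivSubtypeInter _ (fun T : ℕ → ℕ → ℕ =>
          ∀ k, skewContent a (fun _ => 0) T k = c k)).symm
    _ ≃ {g : Tab n a // wt n g.1 = vec n c} :=
        (skewEquiv n (fun i => Nat.zero_le (a i)) ha fun _ _ _ => le_rfl).subtypeEquiv fun T => by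
        have h1 := isTab_toChain (fun i => Nat.zero_le (a i)) ha (fun _ _ _ => le_rfl) T.2
        have h2 := chainRel_toChain T.2
        change _ ↔ wt n (toChain a (fun _ => 0) T.1) = vec n c
        constructor
        · intro h
          funext k
          rw [wt, vec, ← skewContent_eq ha0 h1 h2, h]
        · intro h k
          by_cases hk : k < n
          · have := congrFun h ⟨k, hk⟩
            rw [wt, vec, ← skewContent_eq ha0 h1 h2] at this
            exact_mod_cast this
          · rw [← Int.ofNat_inj, skewContent_eq ha0 h1 h2, hc k (by omega)]
            apply Finset.sum_eq_zero
            intro i _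
            rw [h1.last (k + 1) i (by omega), h1.last k i (by omega), sub_self]

end

noncomputable section

lemma chainSum_succ (n : ℕ) {r : ℕ} (b : ℕ → ℕ) (g : Fin r → ℕ → ℕ → ℕ) (k : Fin r) (i : ℕ) :
    chainSum n b g k.succ i = chainSum n b g k.castSucc i + (wtF n (g k) i).toNat := by
  simp only [chainSum, add_assoc, add_right_inj]
  have h : ∀ k' : Fin r, (if k'.castSucc < k.succ then (wtF n (g k') i).toNat else 0) =
      (if k'.castSucc < k.castSucc then (wtF n (g k') i).toNat else 0) +
        if k' = k then (wtF n (g k') i).toNat else 0 := by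
    intro k'
    rcases lt_trichotomy k' k with h | rfl | h
    · rw [if_pos (by simpa using h.le), if_pos (by simpa using h), if_neg h.ne, add_zero]
    · rw [if_pos (by simp), if_neg (by simp), if_pos rfl, zero_add]
    · rw [if_neg (by simpa using h), if_neg (by simpa using h.le), if_neg h.ne']
  rw [Finset.sum_congr rfl fun k' _ => h k', Finset.sum_add_distrib]
  simp

lemma LRMultiF.supp {n r : ℕ} {a : ℕ → ℕ} (M : LRMultiF r a) (ha : ∀ i, n ≤ i → a i = 0)
    (k : Fin (r + 1)) : ∀ i, n ≤ i → M.chain k i = 0 := by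
  intro i hi
  have h : Monotone fun k => M.chain k i := Fin.monotone_iff_le_succ.2 fun k => M.mono k i
  have h1 := h (Fin.le_last k)
  simp only [M.last, ha i hi] at h1
  omega

lemma LRMultiF.ext' {r : ℕ} {a : ℕ → ℕ} {M M' : LRMultiF r a} (h1 : M.chain = M'.chain)
    (h2 : M.T = M'.T) : M = M' := by
  cases M
  cases M'
  subst h1 h2
  rfl

/-- The transposed chains of a Littlewood–Richardson multitableau. -/
def LRMultiF.trans {r : ℕ} {a : ℕ → ℕ} (M : LRMultiF r a) (k : Fin r) : ℕ → ℕ → ℕ :=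
  transChain (fun _ => 0) (toChain (M.chain k.succ) (M.chain k.castSucc) (M.T k))

lemma LRMultiF.trans_spec {n r : ℕ} {a : ℕ → ℕ} (ha : ∀ i, n ≤ i → a i = 0)
    {l : Fin r → ℕ → ℕ} (hl : ∀ k i, n ≤ i → l k i = 0) (M : LRMultiF r a)
    (hM : ∀ k, M.cont k = l k) (k : Fin r) :
    IsTab n (fun _ => 0) (l k) (M.trans k) ∧ IsDominant (M.chain k.castSucc) (M.trans k) ∧
      ∀ i, M.chain k.castSucc i + wtF n (M.trans k) i = M.chain k.succ i :=
  (lrEquiv (M.mono k) (M.antitone _) (M.antitone _) (M.supp ha _) (hl k) ⟨M.T k, M.lr k, hM k⟩).2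

lemma LRMultiF.chainSum_trans {n r : ℕ} {a : ℕ → ℕ} (ha : ∀ i, n ≤ i → a i = 0)
    {l : Fin r → ℕ → ℕ} (hl : ∀ k i, n ≤ i → l k i = 0) (M : LRMultiF r a)
    (hM : ∀ k, M.cont k = l k) (k : Fin (r + 1)) :
    chainSum n (fun _ => 0) M.trans k = M.chain k := by
  induction k using Fin.induction with
  | zero =>
    rw [chainSum_zero]
    funext i
    rw [M.zero]
  | succ k ih =>
    funext i
    rw [chainSum_succ, ih]
    have h := M.trans_spec ha hl hM k
    have h1 := h.2.2 i
    have h2 := wtF_nonneg h.1.mono n i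
    omega

/-- Littlewood–Richardson multitableaux of given contents correspond to successively dominant
tuples of tableaux. -/
lemma exists_multi_equiv {n r : ℕ} {m : Fin r → ℕ} {a : ℕ → ℕ} (ha : ∀ i, n ≤ i → a i = 0)
    (lam : ∀ k, Shape n (m k)) :
    Nonempty ({M : LRMultiF r a // ∀ k, M.cont k = (lam k).1} ≃
      {g : (∀ k, Tab n (lam k).1) // DomTuple n (fun _ => 0) (fun k => (g k).1) ∧
        chainSum n (fun _ => 0) (fun k => (g k).1) (Fin.last r) = a}) := by
  have hl : ∀ k i, n ≤ i → (lam k).1 i = 0 := fun k => (lam k).2.supp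
  refine ⟨Equiv.ofBijective (fun M => ⟨fun k => ⟨M.1.trans k,
    (M.1.trans_spec ha hl M.2 k).1⟩, ?_, ?_⟩) ⟨?_, ?_⟩⟩
  · intro k
    change IsDominant (chainSum n (fun _ => 0) M.1.trans k.castSucc) _
    rw [M.1.chainSum_trans ha hl M.2]
    exact (M.1.trans_spec ha hl M.2 k).2.1
  · change chainSum n (fun _ => 0) M.1.trans _ = a
    rw [M.1.chainSum_trans ha hl M.2]
    funext i
    exact M.1.last i
  · rintro ⟨M, hM⟩ ⟨M', hM'⟩ h
    have ht : M.trans = M'.trans := by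
      funext k
      exact congrArg Subtype.val (congrFun (congrArg Subtype.val h) k)
    have hc : M.chain = M'.chain := by
      funext k
      rw [← M.chainSum_trans ha hl hM, ← M'.chainSum_trans ha hl hM', ht]
    refine Subtype.ext (LRMultiF.ext' hc ?_)
    funext k
    have hlr := M'.lr k
    have hcont := hM' k
    have htk : transChain (fun _ => 0) (toChain (M'.chain k.succ) (M'.chain k.castSucc) (M'.T k)) =
      M.trans k := (congrFun ht k).symm
    rw [LRMultiF.cont] at hcont
    rw [← hc] at hlr hcont htk
    have := (lrEquiv (M.mono k) (M.antitone _) (M.antitone _) (M.supp ha _) (hl k)).injective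
      (a₁ := ⟨M.T k, M.lr k, hM k⟩) (a₂ := ⟨M'.T k, hlr, hcont⟩) (Subtype.ext htk.symm)
    exact congrArg Subtype.val this
  · rintro ⟨g, hd, hg⟩
    set c := chainSum n (fun _ => 0) (fun k => (g k).1) with hc
    have hs : ∀ k, ∃ m', IsShape n m' (c k) := isShape_chainSum lam (isShape_zero n) g hd
    have hanti : ∀ k i j, i ≤ j → c k j ≤ c k i := fun k => (hs k).choose_spec.anti
    have hsupp : ∀ k i, n ≤ i → c k i = 0 := fun k => (hs k).choose_spec.supp
    have hmono : ∀ (k : Fin r) i, c k.castSucc i ≤ c k.succ i := fun k i => by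
      rw [hc, chainSum_succ]
      exact Nat.le_add_right _ _
    have hdiff : ∀ (k : Fin r) i, (c k.castSucc i : ℤ) + wtF n (g k).1 i = c k.succ i := by
      intro k i
      rw [hc, chainSum_succ]
      have := wtF_nonneg (g k).2.mono n i
      omega
    let e := fun k : Fin r => lrEquiv (hmono k) (hanti k.succ) (hanti k.castSucc) (hsupp k.succ) (hl k)
    let T := fun k : Fin r => (e k).symm ⟨(g k).1, (g k).2, hd k, hdiff k⟩
    refine ⟨⟨⟨c, hanti, fun i => by rw [hc, chainSum_zero], fun i => by rw [hg], hmono,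
      fun k => (T k).1, fun k => (T k).2.1⟩, fun k => (T k).2.2⟩, ?_⟩
    apply Subtype.ext
    funext k
    have h := congrArg Subtype.val ((e k).apply_symm_apply ⟨(g k).1, (g k).2, hd k, hdiff k⟩)
    exact Subtype.ext h

/-- Pairs of multitableaux, sorted by their common contents. -/
def lrPairsEquiv {n r : ℕ} {ν : Fin r → ℕ} (hν : ∀ k, ν k ≤ n) {a b : ℕ → ℕ}
    (ha : ∀ i, n ≤ i → a i = 0) (hb : ∀ i, n ≤ i → b i = 0) :
    LRPairs r a b ν ≃ Σ lam : (∀ k, Shape n (ν k)),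
      {M : LRMultiF r a // ∀ k, M.cont k = (lam k).1} ×
      {M : LRMultiF r b // ∀ k, M.cont k = (lam k).1} where
  toFun x := ⟨fun k => ⟨x.1.1.cont k, isShape_skewContent (x.1.1.supp ha _) (x.1.1.lr k) (x.2.1 k)
      (hν k)⟩, ⟨x.1.1, fun _ => rfl⟩, ⟨x.1.2, fun k => (x.2.2.2 k).symm⟩⟩
  invFun y := ⟨(y.2.1.1, y.2.2.1), by
    obtain ⟨lam, ⟨M, hM⟩, ⟨M', hM'⟩⟩ := y
    refine ⟨fun k => ?_, fun k => ?_, fun k => (hM k).trans (hM' k).symm⟩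
    · rw [LRMultiF.size, ← sum_skewContent_eq (M.supp ha _) _ (M.T k) (N := n)]
      · change ∑ i ∈ range n, M.cont k i = _
        rw [hM, (lam k).2.total]
      · intro i hi
        change M.cont k i = 0
        rw [hM, (lam k).2.supp i hi]
    · rw [LRMultiF.size, ← sum_skewContent_eq (M'.supp hb _) _ (M'.T k) (N := n)]
      · change ∑ i ∈ range n, M'.cont k i = _
        rw [hM', (lam k).2.total]
      · intro i hi
        change M'.cont k i = 0
        rw [hM', (lam k).2.supp i hi]⟩
  left_inv x := rfl
  right_inv y := by
    obtain ⟨lam, ⟨M, hM⟩, ⟨M', hM'⟩⟩ := y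
    have h : ∀ k, IsShape n (ν k) (M.cont k) := fun k => hM k ▸ (lam k).2
    obtain rfl : lam = fun k => ⟨M.cont k, h k⟩ := funext fun k => Subtype.ext (hM k).symm
    rfl

/-- The number of multitableaux as an alternating sum over tuples of tableaux. -/
lemma card_multi_eq_sum {n r : ℕ} {m : Fin r → ℕ} {m' : ℕ} {a : ℕ → ℕ} (ha : IsShape n m' a)
    (lam : ∀ k, Shape n (m k)) :
    (Nat.card {M : LRMultiF r a // ∀ k, M.cont k = (lam k).1} : ℚ) =
      ∑ g : (∀ k, Tab n (lam k).1), altDelta a (shiftVec (∑ k, wt n (g k).1)) := by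
  rw [Nat.card_congr (exists_multi_equiv ha.supp lam).some, sum_tuple_altDelta lam ha]

end

noncomputable section

lemma card_lrPairs {n r : ℕ} {ν : Fin r → ℕ} (hν : ∀ k, ν k ≤ n) {m m' : ℕ} {a b : ℕ → ℕ}
    (ha : IsShape n m a) (hb : IsShape n m' b) :
    (lrNum r a b ν : ℚ) = ∑ lam : (∀ k, Shape n (ν k)),
      (∑ g : (∀ k, Tab n (lam k).1), altDelta a (shiftVec (∑ k, wt n (g k).1))) *
      ∑ g : (∀ k, Tab n (lam k).1), altDelta b (shiftVec (∑ k, wt n (g k).1)) := by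
  have (lam : ∀ k, Shape n (ν k)) :
      Finite {M : LRMultiF r a // ∀ k, M.cont k = (lam k).1} :=
    Finite.of_equiv _ (exists_multi_equiv ha.supp lam).some.symm
  have (lam : ∀ k, Shape n (ν k)) :
      Finite {M : LRMultiF r b // ∀ k, M.cont k = (lam k).1} :=
    Finite.of_equiv _ (exists_multi_equiv hb.supp lam).some.symm
  rw [lrNum, Nat.card_congr (lrPairsEquiv hν ha.supp hb.supp), Nat.card_sigma, Nat.cast_sum]
  refine Finset.sum_congr rfl fun lam _ => ?_
  rw [Nat.card_prod, Nat.cast_mul, card_multi_eq_sum ha, card_multi_eq_sum hb]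

/-- Tuples of triples consisting of a shape and two tableaux. -/
def piSigmaProdEquiv {ι : Type*} {A : ι → Type*} {B C : ∀ i, A i → Type*} :
    (∀ i, Σ a : A i, B i a × C i a) ≃ Σ a : (∀ i, A i), (∀ i, B i (a i)) × (∀ i, C i (a i)) where
  toFun f := ⟨fun i => (f i).1, fun i => (f i).2.1, fun i => (f i).2.2⟩
  invFun f := fun i => ⟨f.1 i, f.2.1 i, f.2.2 i⟩
  left_inv _ := rfl
  right_inv _ := rfl

lemma lrNum_eq_sum_mat {n r : ℕ} {ν : Fin r → ℕ} (hν : ∀ k, ν k ≤ n) {m m' : ℕ} {a b : ℕ → ℕ}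
    (ha : IsShape n m a) (hb : IsShape n m' b) :
    (lrNum r a b ν : ℚ) = ∑ M : (∀ k, Mat n (ν k)),
      altDelta a (shiftVec (∑ k, rowSum (M k).1)) * altDelta b (shiftVec (∑ k, colSum (M k).1)) := by
  rw [card_lrPairs hν ha hb]
  choose e he using fun k => exists_mat_equiv n (ν k)
  have h1 : ∀ k (M : Mat n (ν k)), rowSum M.1 = wt n (e k M).2.1.1 := fun k M =>
    congrArg Prod.fst (he k M)
  have h2 : ∀ k (M : Mat n (ν k)), colSum M.1 = wt n (e k M).2.2.1 := fun k M =>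
    congrArg Prod.snd (he k M)
  have h3 := Fintype.sum_equiv ((Equiv.piCongrRight e).trans piSigmaProdEquiv)
    (fun M : (∀ k, Mat n (ν k)) => altDelta a (shiftVec (∑ k, rowSum (M k).1)) *
      altDelta b (shiftVec (∑ k, colSum (M k).1)))
    (fun x => altDelta a (shiftVec (∑ k, wt n (x.2.1 k).1)) *
      altDelta b (shiftVec (∑ k, wt n (x.2.2 k).1))) (fun M => by
        simp only [h1, h2]
        rfl)
  rw [h3, Fintype.sum_sigma]
  refine Finset.sum_congr rfl fun lam _ => ?_
  rw [Finset.sum_mul_sum, Fintype.sum_prod_type]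

/-- The number of points of each color. -/
def count {n : ℕ} {X : Type*} (s : Fin n → X) (x : X) : ℕ := (univ.filter fun i => s i = x).card

lemma sum_count {n : ℕ} {X : Type*} [Fintype X] (s : Fin n → X) : ∑ x, count s x = n := by
  have h := Finset.card_eq_sum_card_fiberwise (f := s) (s := univ) (t := univ)
    (fun _ _ => Finset.mem_coe.2 (Finset.mem_univ _))
  rw [Finset.card_univ, Fintype.card_fin] at h
  simp only [count]
  convert h.symm

lemma count_comp {n : ℕ} {X : Type*} (s : Fin n → X) (h : Perm (Fin n)) :
    count (s ∘ h) = count s := by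
  funext x
  refine Finset.card_bij (fun i _ => h i) ?_ ?_ ?_
  · simp
  · intro i _ j _ hij
    exact h.injective hij
  · intro j hj
    exact ⟨h.symm j, by simpa using hj, by simp⟩

lemma exists_count {n : ℕ} {X : Type*} [Fintype X] (c : X → ℕ) (hc : ∑ x, c x = n) :
    ∃ s : Fin n → X, count s = c := by
  have h : Fintype.card (Fin n) = Fintype.card (Σ x, Fin (c x)) := by simp [hc]
  let e := Fintype.equivOfCardEq h
  refine ⟨fun i => (e i).1, funext fun x => ?_⟩
  rw [count, ← Fintype.card_fin (c x), ← Finset.card_univ]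
  refine (Finset.card_bij (fun j _ => e.symm ⟨x, j⟩) ?_ ?_ ?_).symm
  · simp
  · intro j _ j' _ h
    simpa using h
  · intro i hi
    simp only [Finset.mem_filter, Finset.mem_univ, true_and] at hi
    refine ⟨hi ▸ (e i).2, Finset.mem_univ _, ?_⟩
    rw [Equiv.symm_apply_eq]
    subst hi
    rfl

lemma exists_comp_eq {n : ℕ} {X : Type*} {s t : Fin n → X} (h : count s = count t) :
    ∃ e : Perm (Fin n), s = t ∘ e := by
  obtain ⟨e, he⟩ := exists_equiv_of_sum_eq s t fun x => by
    have := congrFun h x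
    simp only [count] at this
    simpa [Finset.sum_boole] using this
  exact ⟨e, funext he⟩

lemma sum_card_fixing {n : ℕ} {X : Type*} [Fintype X] (c : X → ℕ) (hc : ∑ x, c x = n) :
    ∑ s ∈ univ.filter (fun s : Fin n → X => count s = c),
      (univ.filter fun g : Perm (Fin n) => s ∘ g = s).card = n.factorial := by
  obtain ⟨s₀, hs₀⟩ := exists_count c hc
  have h1 : ∀ s ∈ univ.filter (fun s : Fin n → X => count s = c),
      (univ.filter fun g : Perm (Fin n) => s ∘ g = s).card =
      (univ.filter fun g : Perm (Fin n) => s₀ ∘ g = s).card := by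
    intro s hs
    rw [Finset.mem_filter] at hs
    obtain ⟨e, rfl⟩ := exists_comp_eq (hs.2.trans hs₀.symm)
    refine Finset.card_bij (fun g _ => e * g) ?_ ?_ ?_
    · intro g hg
      simpa [Function.comp_assoc] using hg
    · intro g _ g' _ h
      exact mul_left_cancel h
    · intro g hg
      refine ⟨e⁻¹ * g, ?_, by simp⟩
      rw [Finset.mem_filter] at hg ⊢
      refine ⟨Finset.mem_univ _, ?_⟩
      rw [Function.comp_assoc, ← Equiv.Perm.coe_mul, mul_inv_cancel_left]
      exact hg.2
  rw [Finset.sum_congr rfl h1, ← Finset.card_eq_sum_card_fiberwise]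
  · rw [Finset.card_univ, Fintype.card_perm, Fintype.card_fin]
  · intro g _
    simp [count_comp, hs₀]

/-- Counting colorings up to relabelling of the points. -/
lemma sum_fixed_colorings {n : ℕ} {X : Type*} [Fintype X] [DecidableEq X] (H : (X → ℕ) → ℚ) :
    ∑ g : Perm (Fin n), ∑ s : Fin n → X, (if s ∘ g = s then H (count s) else 0) =
      n.factorial * ∑ c ∈ Finset.piAntidiag univ n, H c := by
  rw [Finset.sum_comm, ← Finset.sum_fiberwise_of_maps_to (s := univ) (g := fun s : Fin n → X => count s)
    (t := Finset.piAntidiag univ n) (fun s _ => by simp [Finset.mem_piAntidiag, sum_count]),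
    Finset.mul_sum]
  refine Finset.sum_congr rfl fun c hc => ?_
  rw [Finset.mem_piAntidiag] at hc
  rw [← sum_card_fixing c hc.1, Nat.cast_sum, Finset.sum_mul]
  refine Finset.sum_congr rfl fun s hs => ?_
  rw [Finset.mem_filter] at hs
  rw [hs.2, ← Finset.sum_filter, Finset.sum_const, nsmul_eq_mul]
  congr!

end

noncomputable section

/-- Colorings with `n` colors fixed by the permutation `g`. -/
abbrev Col {n : ℕ} (g : Perm (Fin n)) := {f : Fin n → Fin n // f ∘ g = f}

/-- The number of points of each color, as an integer vector. -/
def countVec {n : ℕ} (f : Fin n → Fin n) : Fin n → ℤ := fun k => count f k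

lemma isSym_countVec {n : ℕ} (g : Perm (Fin n)) : IsSym (fun f : Col g => countVec f.1) := by
  intro π F
  let e : Col g ≃ Col g := (Equiv.arrowCongr (Equiv.refl (Fin n)) π⁻¹).subtypeEquiv fun f => by
    constructor
    · intro h
      change (π⁻¹ : Perm (Fin n)) ∘ (f ∘ g) = _
      rw [h]
      rfl
    · intro h
      have h1 : (π⁻¹ : Perm (Fin n)) ∘ (f ∘ g) = (π⁻¹ : Perm (Fin n)) ∘ f := h
      exact (Equiv.injective π⁻¹).comp_left h1
  refine Fintype.sum_equiv e _ _ fun f => ?_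
  congr 1
  funext k
  simp only [countVec, Function.comp, count]
  congr 2
  ext i
  simp only [Finset.mem_filter, Finset.mem_univ, true_and]
  change f.1 i = π k ↔ π⁻¹ (f.1 i) = k
  rw [Equiv.Perm.inv_eq_iff_eq]

lemma permCharZ_eq {n : ℕ} (g : Perm (Fin n)) (v : Fin n → ℤ) :
    permCharZ n (fun i => if h : i < n then v ⟨i, h⟩ else 0) g =
      ∑ f : Col g, if countVec f.1 = v then 1 else 0 := by
  rw [permCharZ]
  split_ifs with hv
  · rw [permChar, Finset.sum_boole, ← Fintype.card_subtype, ← Nat.card_eq_fintype_card, Nat.cast_inj]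
    have hv' : ∀ k : Fin n, 0 ≤ v k := fun k => by simpa using hv k
    have hcount : ∀ (f : Fin n → Fin n) (k : Fin n),
        Nat.card {x : Fin n // (f x : ℕ) = k} = count f k := by
      intro f k
      rw [count, Nat.card_eq_fintype_card, Fintype.card_subtype]
      simp only [Fin.val_inj]
      congr!
    refine (Nat.card_eq_of_bijective (fun f => ⟨fun i => (f.1.1 i : ℕ), fun k => ?_, fun x => ?_⟩)
      ⟨?_, ?_⟩).symm
    rotate_left 2
    · by_cases hk : k < n
      · have h := congrFun f.2 ⟨k, hk⟩
        have h1 := hcount f.1.1 ⟨k, hk⟩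
        simp only [countVec] at h
        simp only at h1
        rw [h1, dif_pos hk, ← h, Int.toNat_natCast]
      · rw [dif_neg hk, Int.toNat_zero, Nat.card_eq_zero]
        left
        exact ⟨fun x => hk (x.2 ▸ (f.1.1 x.1).2)⟩
    · exact congrArg Fin.val (congrFun f.1.2 x)
    · intro f f' h
      have h1 := congrArg Subtype.val h
      refine Subtype.ext (Subtype.ext (funext fun i => Fin.ext (congrFun h1 i)))
    · rintro ⟨f, hf, hg⟩
      have hlt : ∀ x, f x < n := by
        intro x
        by_contra hc
        have h := hf (f x)
        rw [dif_neg hc, Int.toNat_zero, Nat.card_eq_zero] at h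
        rcases h with h | h
        · exact h.false ⟨x, rfl⟩
        · exact h.not_finite inferInstance
      refine ⟨⟨⟨fun x => ⟨f x, hlt x⟩, funext fun x => Fin.ext (hg x)⟩, ?_⟩, rfl⟩
      funext k
      have h1 := hcount (fun x => ⟨f x, hlt x⟩) k
      have h2 := hf k
      simp only at h1
      rw [h1, dif_pos k.2] at h2
      rw [countVec, h2, Int.toNat_of_nonneg (hv' k)]
  · symm
    refine Finset.sum_eq_zero fun f _ => if_neg fun h => hv fun k => ?_
    split_ifs with hk
    · rw [← h]
      exact Int.natCast_nonneg _
    · exact le_rfl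

lemma irrChar_eq (n : ℕ) (a : ℕ → ℕ) (g : Perm (Fin n)) :
    irrChar n a g = mult (fun f : Col g => countVec f.1) a := by
  rw [← (isSym_countVec g).alternating_sum a, irrChar]
  refine Finset.sum_congr rfl fun σ _ => ?_
  rw [← permCharZ_eq]

lemma young_rule {n : ℕ} (c : ℕ → ℕ) (hc : ∀ i, n ≤ i → c i = 0) (g : Perm (Fin n)) :
    ∑ γ : Shape n n, (kostka γ.1 c : ℚ) * irrChar n γ.1 g =
      ∑ f : Col g, if countVec f.1 = vec n c then 1 else 0 := by
  have h := (isSym_countVec g).sum_eq (m := n) (fun _ _ => Int.natCast_nonneg _)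
    (fun f => by
      have := sum_count f.1
      simp only [countVec]
      exact_mod_cast this) (fun v => if v = vec n c then 1 else 0)
  rw [h]
  refine Finset.sum_congr rfl fun γ _ => ?_
  rw [irrChar_eq, kostka_eq γ.2.anti γ.2.supp hc, mul_comm, Nat.card_eq_fintype_card,
    Fintype.card_subtype, Finset.sum_boole]

/-- Three colorings fixed by a permutation are a fixed coloring with triples of colors. -/
lemma sum_triple {n : ℕ} (g : Perm (Fin n)) (F : (Fin n → Fin n) → (Fin n → Fin n) →
    (Fin n → Fin n) → ℚ) :
    ∑ f₁ : Col g, ∑ f₂ : Col g, ∑ f₃ : Col g, F f₁.1 f₂.1 f₃.1 =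
      ∑ s : Fin n → Fin n × Fin n × Fin n, if s ∘ g = s then
        F (fun i => (s i).1) (fun i => (s i).2.1) (fun i => (s i).2.2) else 0 := by
  simp only [← Fintype.sum_prod_type']
  rw [← Finset.sum_filter, Finset.sum_subtype (p := fun s => s ∘ g = s) _ (by simp)]
  let e : Col g × Col g × Col g ≃ {s : Fin n → Fin n × Fin n × Fin n // s ∘ g = s} :=
    ⟨fun f => ⟨fun i => (f.1.1 i, f.2.1.1 i, f.2.2.1 i), funext fun i =>
        Prod.ext (congrFun f.1.2 i) (Prod.ext (congrFun f.2.1.2 i) (congrFun f.2.2.2 i))⟩,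
      fun s => ⟨⟨fun i => (s.1 i).1, funext fun i => congrArg (fun x => x.1) (congrFun s.2 i)⟩,
        ⟨fun i => (s.1 i).2.1, funext fun i => congrArg (fun x => x.2.1) (congrFun s.2 i)⟩,
        ⟨fun i => (s.1 i).2.2, funext fun i => congrArg (fun x => x.2.2) (congrFun s.2 i)⟩⟩,
      fun _ => rfl, fun _ => rfl⟩
  exact Fintype.sum_equiv e _ _ fun _ => rfl

lemma count_comp_fst {n : ℕ} {X Y : Type*} [Fintype X] (s : Fin n → X) (p : X → Y) (y : Y) :
    count (fun i => p (s i)) y = ∑ x, if p x = y then count s x else 0 := by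
  have h := Finset.card_eq_sum_card_fiberwise (f := s) (s := univ.filter fun i => p (s i) = y)
    (t := univ) (fun _ _ => Finset.mem_coe.2 (Finset.mem_univ _))
  rw [count]
  convert h using 2 with x
  rw [Finset.filter_filter, count]
  split_ifs with hx
  · congr 1
    ext i
    simp only [Finset.mem_filter, Finset.mem_univ, true_and]
    exact ⟨fun h => ⟨h ▸ hx, h⟩, fun h => h.2⟩
  · symm
    rw [Finset.card_eq_zero, Finset.filter_eq_empty_iff]
    rintro i _ ⟨h1, h2⟩
    exact hx (h2 ▸ h1)

lemma marginal {X Y Z : Type*} [Fintype X] [Fintype Y] [Fintype Z] (c : X × Y × Z → ℕ) :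
    (∀ x, (∑ p, if p.1 = x then c p else 0) = ∑ z, ∑ y, c (x, y, z)) ∧
    (∀ y, (∑ p, if p.2.1 = y then c p else 0) = ∑ z, ∑ x, c (x, y, z)) ∧
    ∀ z, (∑ p, if p.2.2 = z then c p else 0) = ∑ y, ∑ x, c (x, y, z) := by
  refine ⟨fun x => ?_, fun y => ?_, fun z => ?_⟩ <;> simp only [Fintype.sum_prod_type]
  · rw [Finset.sum_eq_single x]
    · simp only [if_true]
      exact Finset.sum_comm
    · intro b _ hb
      simp [hb]
    · simp
  · rw [Finset.sum_comm]
    rw [Finset.sum_eq_single y]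
    · simp only [if_true]
      exact Finset.sum_comm
    · intro b _ hb
      simp [hb]
    · simp
  · rw [Finset.sum_comm]
    simp

/-- The inner product of a product of two irreducible characters with a permutation character
counts tuples of matrices. -/
lemma sum_char {n : ℕ} (a b c : ℕ → ℕ) (hc : ∑ i : Fin n, c i = n) :
    ∑ g : Perm (Fin n), irrChar n a g * irrChar n b g *
      (∑ f : Col g, if countVec f.1 = vec n c then 1 else 0) =
    n.factorial * ∑ M : (∀ k : Fin n, Mat n (c k)),
      altDelta a (shiftVec (∑ k, rowSum (M k).1)) *
      altDelta b (shiftVec (∑ k, colSum (M k).1)) := by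
  have h1 : ∀ g : Perm (Fin n), irrChar n a g * irrChar n b g *
      (∑ f : Col g, if countVec f.1 = vec n c then 1 else 0) =
      ∑ f₁ : Col g, ∑ f₂ : Col g, ∑ f₃ : Col g, altDelta a (shiftVec (countVec f₁.1)) *
        altDelta b (shiftVec (countVec f₂.1)) * if countVec f₃.1 = vec n c then 1 else 0 := by
    intro g
    rw [irrChar_eq, irrChar_eq, mult, mult, Finset.sum_mul_sum, Finset.sum_mul]
    refine Finset.sum_congr rfl fun f₁ _ => ?_
    rw [Finset.sum_mul]
    refine Finset.sum_congr rfl fun f₂ _ => ?_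
    rw [Finset.mul_sum]
  let H : (Fin n × Fin n × Fin n → ℕ) → ℚ := fun c' =>
    altDelta a (shiftVec fun x => ((∑ z, ∑ y, c' (x, y, z) : ℕ) : ℤ)) *
    altDelta b (shiftVec fun y => ((∑ z, ∑ x, c' (x, y, z) : ℕ) : ℤ)) *
    if ∀ z, ∑ y, ∑ x, c' (x, y, z) = c z then 1 else 0
  have h2 : ∀ s : Fin n → Fin n × Fin n × Fin n,
      altDelta a (shiftVec (countVec fun i => (s i).1)) *
      altDelta b (shiftVec (countVec fun i => (s i).2.1)) *
      (if countVec (fun i => (s i).2.2) = vec n c then 1 else 0) = H (count s) := by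
    intro s
    obtain ⟨m1, m2, m3⟩ := marginal (count s)
    have e1 : countVec (fun i => (s i).1) = fun x => ((∑ z, ∑ y, count s (x, y, z) : ℕ) : ℤ) :=
      funext fun x => by rw [← m1, countVec, count_comp_fst s fun p => p.1]
    have e2 : countVec (fun i => (s i).2.1) = fun y => ((∑ z, ∑ x, count s (x, y, z) : ℕ) : ℤ) :=
      funext fun y => by rw [← m2, countVec, count_comp_fst s fun p => p.2.1]
    have e3 : countVec (fun i => (s i).2.2) = fun z => ((∑ y, ∑ x, count s (x, y, z) : ℕ) : ℤ) :=
      funext fun z => by rw [← m3, countVec, count_comp_fst s fun p => p.2.2]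
    rw [e1, e2, e3]
    simp only [H, vec, funext_iff, Nat.cast_inj]
  simp only [h1]
  rw [Finset.sum_congr rfl fun g _ => sum_triple g fun f₁ f₂ f₃ =>
    altDelta a (shiftVec (countVec f₁)) * altDelta b (shiftVec (countVec f₂)) *
      if countVec f₃ = vec n c then 1 else 0]
  simp only [h2]
  refine Eq.trans (by congr!) ((sum_fixed_colorings H).trans ?_)
  congr 1
  simp only [H, mul_ite, mul_one, mul_zero]
  rw [← Finset.sum_filter]
  symm
  refine Finset.sum_bij' (fun M _ => fun p => (M p.2.2).1 p.2.1 p.1)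
    (fun c' hc' => fun k => ⟨fun y x => c' (x, y, k), (Finset.mem_filter.1 hc').2 k⟩)
    ?_ ?_ ?_ ?_ ?_
  · intro M _
    rw [Finset.mem_filter, Finset.mem_piAntidiag]
    have h3 : ∀ z : Fin n, ∑ y, ∑ x, (M z).1 y x = c z := fun z => (M z).2
    refine ⟨⟨?_, by simp⟩, h3⟩
    rw [Fintype.sum_prod_type]
    simp only [Fintype.sum_prod_type]
    rw [Finset.sum_comm, Finset.sum_congr rfl fun y _ => Finset.sum_comm, Finset.sum_comm]
    exact (Finset.sum_congr rfl fun z _ => h3 z).trans hc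
  · simp
  · intro M _
    rfl
  · intro c' _
    rfl
  · intro M _
    congr 3
    · funext x
      simp [rowSum]
    · funext y
      simp [colSum]

end

noncomputable section

lemma dominates_of_tab {n : ℕ} {a c : ℕ → ℕ} (hc : ∀ i, n ≤ i → c i = 0) (g : Tab n a)
    (hg : wt n g.1 = vec n c) : Dominates a c := by
  obtain ⟨g, h⟩ := g
  have h1 : ∀ k, (c k : ℤ) = wtF n g k := by
    intro k
    by_cases hk : k < n
    · exact (congrFun hg ⟨k, hk⟩).symm
    · rw [hc k (by omega)]
      symm
      apply Finset.sum_eq_zero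
      intro i _
      rw [h.last (k + 1) i (by omega), h.last k i (by omega), sub_self]
  intro K
  have h2 : ∑ k ∈ range K, c k = ∑ i ∈ range n, g K i := by
    zify
    simp only [h1, wtF]
    rw [Finset.sum_comm]
    refine Finset.sum_congr rfl fun i _ => ?_
    rw [Finset.sum_range_sub (fun k => (g k i : ℤ)), h.zero]
    simp
  rw [h2]
  calc ∑ i ∈ range n, g K i ≤ ∑ i ∈ range (max n K), g K i :=
        Finset.sum_le_sum_of_subset (by simp)
    _ = ∑ i ∈ range K, g K i := by
        symm
        apply Finset.sum_subset (by simp)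
        intro i _ hi
        exact h.eq_zero K i (by simpa using hi)
    _ ≤ ∑ i ∈ range K, a i := Finset.sum_le_sum fun i _ => h.le_last K i

lemma sum_range_getD (l : List ℕ) {N : ℕ} (h : l.length ≤ N) :
    ∑ i ∈ range N, l.getD i 0 = l.sum := by
  induction l generalizing N with
  | nil => simp
  | cons x l ih =>
    obtain ⟨N, rfl⟩ : ∃ N', N = N' + 1 := ⟨N - 1, by simp at h; omega⟩
    rw [Finset.sum_range_succ', List.sum_cons]
    simp only [List.getD_cons_succ, List.getD_cons_zero]
    rw [ih (by simpa using h), add_comm]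

/-- The parts of a partition in weakly decreasing order. -/
def partsList {n : ℕ} (P : n.Partition) : List ℕ := (P.parts.sort (· ≤ ·)).reverse

lemma coe_partsList {n : ℕ} (P : n.Partition) : (partsList P : Multiset ℕ) = P.parts := by
  rw [partsList, Multiset.coe_reverse, Multiset.sort_eq]

lemma pairwise_partsList {n : ℕ} (P : n.Partition) : (partsList P).Pairwise (· ≥ ·) := by
  rw [partsList, List.pairwise_reverse]
  exact Multiset.pairwise_sort _ _

lemma pos_of_mem_partsList {n : ℕ} (P : n.Partition) {x : ℕ} (hx : x ∈ partsList P) : 0 < x := by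
  apply P.parts_pos
  rwa [← coe_partsList, Multiset.mem_coe]

lemma isShape_pf {n : ℕ} (P : n.Partition) : IsShape n n (pf P) := by
  have hs : (partsList P).sum = n := by
    rw [← Multiset.sum_coe, coe_partsList, P.parts_sum]
  have hl : (partsList P).length ≤ n := by
    conv_rhs => rw [← hs]
    exact List.length_le_sum_of_one_le _ fun x hx => pos_of_mem_partsList P hx
  refine ⟨fun i j hij => ?_, fun i hi => ?_, ?_⟩
  · change (partsList P).getD j 0 ≤ (partsList P).getD i 0
    by_cases hj : j < (partsList P).length
    · rw [List.getD_eq_getElem _ _ hj, List.getD_eq_getElem _ _ (by omega)]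
      rcases hij.eq_or_lt with rfl | hij
      · exact le_rfl
      · exact List.pairwise_iff_getElem.1 (pairwise_partsList P) i j (by omega) hj hij
    · rw [List.getD_eq_default _ _ (by omega)]
      exact Nat.zero_le _
  · exact List.getD_eq_default _ _ (hl.trans hi)
  · exact (sum_range_getD _ hl).trans hs

lemma pf_injective (n : ℕ) : Function.Injective (pf : n.Partition → ℕ → ℕ) := by
  have key : ∀ P Q : n.Partition, pf P = pf Q → (partsList P).length ≤ (partsList Q).length := by
    intro P Q h
    by_contra hc
    have h1 : (partsList P).getD (partsList Q).length 0 = (partsList Q).getD (partsList Q).length 0 :=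
      congrFun h _
    rw [List.getD_eq_getElem _ _ (by omega), List.getD_eq_default _ _ le_rfl] at h1
    have := pos_of_mem_partsList P (List.getElem_mem (by omega : (partsList Q).length < _))
    omega
  intro P Q h
  have h1 : partsList P = partsList Q := by
    refine List.ext_getElem (le_antisymm (key P Q h) (key Q P h.symm)) fun i hi hi' => ?_
    have h1 : (partsList P).getD i 0 = (partsList Q).getD i 0 := congrFun h i
    rwa [List.getD_eq_getElem _ _ hi, List.getD_eq_getElem _ _ hi'] at h1
  apply Nat.Partition.ext
  rw [← coe_partsList, ← coe_partsList, h1]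

lemma exists_pf_eq {n : ℕ} {a : ℕ → ℕ} (ha : IsShape n n a) : ∃ P : n.Partition, pf P = a := by
  have hex : ∃ i, a i = 0 := ⟨n, ha.supp n le_rfl⟩
  set m := Nat.find hex with hm
  have hpos : ∀ i, i < m → 0 < a i := fun i hi => Nat.pos_of_ne_zero (Nat.find_min hex hi)
  have hzero : ∀ i, m ≤ i → a i = 0 := by
    intro i hi
    have h1 := ha.anti m i hi
    have h2 : a m = 0 := Nat.find_spec hex
    omega
  have hmn : m ≤ n := Nat.find_min' hex (ha.supp n le_rfl)
  set L := (List.range m).map a with hL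
  have hget : ∀ i, L.getD i 0 = a i := by
    intro i
    by_cases hi : i < m
    · rw [List.getD_eq_getElem _ _ (by simpa [hL] using hi)]
      simp [hL]
    · rw [List.getD_eq_default _ _ (by simpa [hL] using hi), hzero i (by omega)]
  have hsum : L.sum = n := by
    rw [← sum_range_getD L (N := n) (by simpa [hL] using hmn)]
    simp only [hget]
    exact ha.total
  let P : n.Partition := ⟨(L : Multiset ℕ), fun {i} hi => by
    rw [Multiset.mem_coe, hL, List.mem_map] at hi
    obtain ⟨j, hj, rfl⟩ := hi
    exact hpos j (List.mem_range.1 hj), by rw [Multiset.sum_coe, hsum]⟩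
  have hLs : L.Pairwise (· ≥ ·) := by
    rw [hL, List.pairwise_map]
    exact List.pairwise_lt_range.imp fun h => ha.anti _ _ h.le
  have hPL : partsList P = L :=
    (Multiset.coe_eq_coe.1 (coe_partsList P)).eq_of_pairwise' (pairwise_partsList P) hLs
  refine ⟨P, funext fun i => ?_⟩
  change (partsList P).getD i 0 = a i
  rw [hPL, hget]

lemma sum_partition {n : ℕ} (F : (ℕ → ℕ) → ℚ) :
    ∑ γ : n.Partition, F (pf γ) = ∑ γ : Shape n n, F γ.1 := by
  refine Fintype.sum_equiv (Equiv.ofBijective (fun P : n.Partition =>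
    (⟨pf P, isShape_pf P⟩ : Shape n n)) ⟨?_, ?_⟩) _ _ fun _ => rfl
  · intro P Q h
    exact pf_injective n (congrArg Subtype.val h)
  · rintro ⟨a, ha⟩
    obtain ⟨P, hP⟩ := exists_pf_eq ha
    exact ⟨P, Subtype.ext hP⟩

end

/-- `lr(α,β;ν) = ∑_{γ ⊵ ν} K_{γν} k(α,β,γ)`. -/
theorem stmt10 (n : ℕ) (α β ν : n.Partition) :
    (lrNum n (pf α) (pf β) (pfin ν) : ℚ) =
      ∑ γ : n.Partition,
        if Dominates (pf γ) (pf ν) then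
          (kostka (pf γ) (pf ν) : ℚ) * kron n (pf α) (pf β) (pf γ)
        else 0 := by

  have hα := isShape_pf α
  have hβ := isShape_pf β
  have hν := isShape_pf ν
  have hle : ∀ k : Fin n, pfin ν k ≤ n := by
    intro k
    have h1 := Finset.single_le_sum (f := pf ν) (fun i _ => Nat.zero_le _)
      (Finset.mem_range.2 k.2)
    rw [hν.total] at h1
    exact h1
  have hsum : ∑ i : Fin n, pf ν i = n := by
    rw [← Finset.sum_range (pf ν), hν.total]
  have hdom : ∀ γ : n.Partition, (if Dominates (pf γ) (pf ν) then
      (kostka (pf γ) (pf ν) : ℚ) * kron n (pf α) (pf β) (pf γ) else 0) =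
      (kostka (pf γ) (pf ν) : ℚ) * kron n (pf α) (pf β) (pf γ) := by
    intro γ
    split_ifs with h
    · rfl
    · have hγ := isShape_pf γ
      have : IsEmpty {g : Tab n (pf γ) // wt n g.1 = vec n (pf ν)} :=
        ⟨fun g => h (dominates_of_tab hν.supp g.1 g.2)⟩
      rw [kostka_eq hγ.anti hγ.supp hν.supp, Nat.card_of_isEmpty, Nat.cast_zero, zero_mul]
  have hn : (n.factorial : ℚ) ≠ 0 := by exact_mod_cast n.factorial_ne_zero
  calc (lrNum n (pf α) (pf β) (pfin ν) : ℚ)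
      = (∑ g, irrChar n (pf α) g * irrChar n (pf β) g *
          (∑ f : Col g, if countVec f.1 = vec n (pf ν) then 1 else 0)) / n.factorial := by
        rw [sum_char _ _ _ hsum, mul_div_cancel_left₀ _ hn]
        exact lrNum_eq_sum_mat hle hα hβ
    _ = ∑ γ : Shape n n, (kostka γ.1 (pf ν) : ℚ) * kron n (pf α) (pf β) γ.1 := by
        simp only [kron, innerChar, ← mul_div_assoc, ← Finset.sum_div, Finset.mul_sum]
        rw [Finset.sum_comm]
        congr 1
        refine Finset.sum_congr rfl fun g _ => ?_
        rw [← Finset.mul_sum, ← young_rule _ hν.supp, Finset.mul_sum]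
        exact Finset.sum_congr rfl fun γ _ => by ring
    _ = _ := by
        rw [← sum_partition fun a => (kostka a (pf ν) : ℚ) * kron n (pf α) (pf β) a]
        exact Finset.sum_congr rfl fun γ _ => (hdom γ).symm
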